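/- Every irreducible plane algebraic curve can be transformed by a finite sequence of quadratic (Cremona) transformations into a curve whose singular points are all ordinary, i.e., each singular point of multiplicity m has m distinct tangent lines. -/

import Mathlib

open MvPolynomial

variable {k : Type} [Field k]

/-- Iterated partial derivatives along a list of variable indices. -/
noncomputable def pderivList {n : ℕ} (s : List (Fin n)) (F : MvPolynomial (Fin n) k) :
    MvPolynomial (Fin n) k :=
  s.foldr (fun i G => pderiv i G) F

/-- The `m`-th directional derivative of `F` at `v` in direction `w`
(`m!` times the degree-`m` Taylor form). -/
noncomputable def dirDeriv {n : ℕ} (F : MvPolynomial (Fin n) k)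
    (v w : Fin n → k) (m : ℕ) : k :=
  ∑ s : Fin m → Fin n, eval v (pderivList (List.ofFn s) F) * ∏ j, w (s j)

/-- `F` has multiplicity (exactly) `m` at the point `v`: all partial derivatives of
order `< m` vanish at `v`, while some order-`m` derivative does not. -/
def HasMultiplicityAt {n : ℕ} (F : MvPolynomial (Fin n) k) (v : Fin n → k) (m : ℕ) : Prop :=
  (∀ s : List (Fin n), s.length < m → eval v (pderivList s F) = 0) ∧
    ∃ s : List (Fin n), s.length = m ∧ eval v (pderivList s F) ≠ 0

/-- A singular point of the projective plane curve `F = 0`. -/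
def IsSingularAt (F : MvPolynomial (Fin 3) k) (v : Fin 3 → k) : Prop :=
  v ≠ 0 ∧ eval v F = 0 ∧ ∀ i, eval v (pderiv i F) = 0

/-- A node (ordinary double point): multiplicity two with two distinct tangent
directions, i.e. the degree-2 tangent cone is not (a multiple of) a square of a linear form. -/
def IsNodeAt (F : MvPolynomial (Fin 3) k) (v : Fin 3 → k) : Prop :=
  v ≠ 0 ∧ eval v F = 0 ∧ HasMultiplicityAt F v 2 ∧
    ¬ ∃ (c : k) (l : Fin 3 → k), ∀ w : Fin 3 → k,
        dirDeriv F v w 2 = c * (∑ i, l i * w i) ^ 2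

/-- An ordinary point of multiplicity `m`: the degree-`m` tangent cone factors into `m`
pairwise distinct linear forms. -/
def IsOrdinaryAt (F : MvPolynomial (Fin 3) k) (v : Fin 3 → k) (m : ℕ) : Prop :=
  HasMultiplicityAt F v m ∧
    ∃ (c : k) (L : Fin m → (Fin 3 → k)), c ≠ 0 ∧
      (∀ i j, i ≠ j → ¬ ∃ t : k, L j = t • L i) ∧
      ∀ w : Fin 3 → k, dirDeriv F v w m = c * ∏ i, (∑ j, L i j * w j)

/-- An (irreducible) plane algebraic curve of degree `n` in `ℙ²`. -/
structure PlaneCurve (k : Type) [Field k] where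
  n : ℕ
  F : MvPolynomial (Fin 3) k
  homog : F.IsHomogeneous n
  irred : Irreducible F

/-- Birational equivalence of the projective curves `F = 0` and `G = 0`, expressed by a
pair of mutually inverse rational maps given by homogeneous polynomial triples. -/
def BirEquiv (F G : MvPolynomial (Fin 3) k) : Prop :=
  ∃ φ ψ : Fin 3 → MvPolynomial (Fin 3) k,
    (∃ d, ∀ i, (φ i).IsHomogeneous d) ∧
    (∃ e, ∀ i, (ψ i).IsHomogeneous e) ∧
    bind₁ φ G ∈ Ideal.span {F} ∧
    bind₁ ψ F ∈ Ideal.span {G} ∧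
    (∃ lam : MvPolynomial (Fin 3) k, lam ∉ Ideal.span {F} ∧
      ∀ i, bind₁ φ (ψ i) - lam * X i ∈ Ideal.span {F}) ∧
    (∃ mu : MvPolynomial (Fin 3) k, mu ∉ Ideal.span {G} ∧
      ∀ i, bind₁ ψ (φ i) - mu * X i ∈ Ideal.span {G})

/-- The standard quadratic Cremona transformation `[x:y:z] ↦ [yz:xz:xy]`,
as a triple of quadratic polynomials. -/
noncomputable def stdQuad (k : Type) [Field k] : Fin 3 → MvPolynomial (Fin 3) k :=
  ![X 1 * X 2, X 0 * X 2, X 0 * X 1]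

/-- Composition of polynomial self-maps of `ℙ²`: `(compMap f g) v = f (g v)`. -/
noncomputable def compMap {k : Type} [Field k]
    (f g : Fin 3 → MvPolynomial (Fin 3) k) : Fin 3 → MvPolynomial (Fin 3) k :=
  fun i => bind₁ g (f i)

/-- The polynomial map given by an invertible linear change of coordinates. -/
noncomputable def linMap {k : Type} [Field k]
    (A : Matrix.GeneralLinearGroup (Fin 3) k) : Fin 3 → MvPolynomial (Fin 3) k :=
  fun i => ∑ j, MvPolynomial.C ((A : Matrix (Fin 3) (Fin 3) k) i j) * X j

/-- A quadratic (Cremona) transformation: a conjugate of the standard quadratic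
transformation by projective linear maps. -/
def IsQuadTrans {k : Type} [Field k] (φ : Fin 3 → MvPolynomial (Fin 3) k) : Prop :=
  ∃ A B : Matrix.GeneralLinearGroup (Fin 3) k,
    φ = compMap (linMap A) (compMap (stdQuad k) (linMap B))

/-- `φ` transforms the curve `F = 0` into the curve `G = 0`: the total pullback of `G`
under `φ` is `F` times an extra factor not divisible by `F` (the exceptional lines). -/
def TransformsInto {k : Type} [Field k] (φ : Fin 3 → MvPolynomial (Fin 3) k)
    (F G : MvPolynomial (Fin 3) k) : Prop :=
  ∃ E : MvPolynomial (Fin 3) k, bind₁ φ G = F * E ∧ ¬ F ∣ E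


/-- The one-parameter Taylor expansion `F(v + t X)`, as a polynomial in `t`. -/
noncomputable def tay {n : ℕ} (v : Fin n → k) :
    MvPolynomial (Fin n) k →ₐ[k] Polynomial (MvPolynomial (Fin n) k) :=
  aeval (fun i => Polynomial.C (C (v i)) + Polynomial.X * Polynomial.C (X i))

lemma tay_X {n : ℕ} (v : Fin n → k) (i : Fin n) :
    tay v (X i) = Polynomial.C (C (v i)) + Polynomial.X * Polynomial.C (X i) := by
  simp [tay]

lemma tay_C {n : ℕ} (v : Fin n → k) (a : k) :
    tay v (C a) = Polynomial.C (C a) := by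
  simp [tay, Polynomial.algebraMap_apply, algebraMap_eq]

lemma tay_derivative {n : ℕ} (v : Fin n → k) (F : MvPolynomial (Fin n) k) :
    Polynomial.derivative (tay v F) = ∑ i, Polynomial.C (X i) * tay v (pderiv i F) := by
  induction F using MvPolynomial.induction_on with
  | C a => simp [tay_C]
  | add p q hp hq => simp [hp, hq, mul_add, Finset.sum_add_distrib]
  | mul_X p j hp =>
    rw [map_mul, Polynomial.derivative_mul, hp, tay_X]
    simp only [Derivation.leibniz, pderiv_X, smul_eq_mul, map_add, map_mul, mul_add,
      Finset.sum_add_distrib, Finset.sum_mul, tay_X]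
    have : ∑ x, Polynomial.C (X x) * (tay v p * tay v (Pi.single (M := fun _ => MvPolynomial (Fin n) k) x 1 j))
        = Polynomial.C (X j) * tay v p := by
      rw [Finset.sum_eq_single j]
      · simp
      · intro b _ hb
        simp [Pi.single_apply, hb.symm]
      · simp
    rw [this]
    simp only [Polynomial.derivative_add, Polynomial.derivative_mul, Polynomial.derivative_C, Polynomial.derivative_X]
    have h2 : ∀ x, Polynomial.C (X x) * ((Polynomial.C (C (v j)) + Polynomial.X * Polynomial.C (X j)) * (tay v) ((pderiv x) p)) = Polynomial.C (X x) * (tay v) ((pderiv x) p) * Polynomial.C (C (v j)) + Polynomial.C (X x) * (tay v) ((pderiv x) p) * (Polynomial.X * Polynomial.C (X j)) := by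
      intro x; ring
    simp only [h2, Finset.sum_add_distrib, ← Finset.sum_mul]
    ring

lemma tay_coeff_pderiv' {n : ℕ} (v : Fin n → k) (i : Fin n) (F : MvPolynomial (Fin n) k) (j : ℕ) :
    pderiv i ((tay v F).coeff j) = (Polynomial.X * tay v (pderiv i F)).coeff j := by
  induction F using MvPolynomial.induction_on generalizing j with
  | C a => simp [tay_C, Polynomial.coeff_C]; split_ifs <;> simp
  | add p q hp hq => simp [hp, hq, mul_add]
  | mul_X p l hp =>
    rw [map_mul, tay_X, mul_add, Polynomial.coeff_add, Polynomial.coeff_mul_C, ← mul_assoc,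
      Polynomial.coeff_mul_C, mul_comm (tay v p) Polynomial.X]
    simp only [Derivation.leibniz, pderiv_X, smul_eq_mul, map_add, map_mul, tay_X, hp, pderiv_C]
    cases j with
    | zero => simp
    | succ j =>
      simp only [Polynomial.coeff_X_mul, mul_add, add_mul, Polynomial.coeff_add, Polynomial.coeff_C_mul,
        mul_zero, add_zero, hp, zero_add, mul_assoc]
      have : ((tay v p) * (tay v (Pi.single (M := fun _ => MvPolynomial (Fin n) k) i 1 l))).coeff j = (tay v p).coeff j * Pi.single (M := fun _ => MvPolynomial (Fin n) k) i 1 l := by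
        by_cases h : l = i
        · subst h; simp
        · simp [Pi.single_apply, h]
      rw [this]
      have h3 : (Polynomial.X * (Polynomial.C (X l) * tay v (pderiv i p))).coeff j = X l * (Polynomial.X * tay v (pderiv i p)).coeff j := by
        rw [← Polynomial.coeff_C_mul]; congr 1; ring
      rw [h3]
      ring

lemma tay_coeff_pderiv {n : ℕ} (v : Fin n → k) (i : Fin n) (F : MvPolynomial (Fin n) k) (j : ℕ) :
    (tay v (pderiv i F)).coeff j = pderiv i ((tay v F).coeff (j+1)) := by
  rw [tay_coeff_pderiv', Polynomial.coeff_X_mul]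

lemma tay_coeff_zero {n : ℕ} (v : Fin n → k) (F : MvPolynomial (Fin n) k) :
    (tay v F).coeff 0 = C (eval v F) := by
  induction F using MvPolynomial.induction_on with
  | C a => simp [tay_C]
  | add p q hp hq => simp [hp, hq]
  | mul_X p l hp => simp [tay_X, hp, Polynomial.mul_coeff_zero]

lemma pderivList_append_single {n : ℕ} (s : List (Fin n)) (i : Fin n) (F : MvPolynomial (Fin n) k) :
    pderivList (s ++ [i]) F = pderivList s (pderiv i F) := by
  simp [pderivList]

lemma eval_pderivList_of_coeff {n : ℕ} (v : Fin n → k) (s : List (Fin n)) (F : MvPolynomial (Fin n) k)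
    (h : (tay v F).coeff s.length = 0) : eval v (pderivList s F) = 0 := by
  induction s using List.reverseRecOn generalizing F with
  | nil =>
    have := tay_coeff_zero v F
    rw [List.length_nil] at h
    rw [h] at this
    simpa [pderivList] using this.symm
  | append_singleton s i ih =>
    rw [pderivList_append_single]
    apply ih
    rw [tay_coeff_pderiv]
    have : (s ++ [i]).length = s.length + 1 := by simp
    rw [← this, h, map_zero]

lemma tay_coeff_formula {n : ℕ} (v : Fin n → k) (j : ℕ) (F : MvPolynomial (Fin n) k) :
    (j.factorial : MvPolynomial (Fin n) k) * (tay v F).coeff j =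
      ∑ s : Fin j → Fin n, C (eval v (pderivList (List.ofFn s) F)) * ∏ i, X (s i) := by
  induction j generalizing F with
  | zero => simp [tay_coeff_zero, pderivList]
  | succ j ih =>
    have h1 := congrArg (fun p => p.coeff j) (tay_derivative v F)
    simp only [Polynomial.coeff_derivative, Polynomial.finsetSum_coeff, Polynomial.coeff_C_mul] at h1
    rw [Nat.factorial_succ]
    push_cast
    calc _ = (j.factorial : MvPolynomial (Fin n) k) * ((tay v F).coeff (j+1) * ((j:MvPolynomial (Fin n) k)+1)) := by ring
      _ = ∑ i, X i * ((j.factorial : MvPolynomial (Fin n) k) * (tay v (pderiv i F)).coeff j) := by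
          rw [h1, Finset.mul_sum]; refine Finset.sum_congr rfl fun i _ => by ring
      _ = _ := by
          simp only [ih]
          rw [← (Fin.snocEquiv (fun _ : Fin (j+1) => Fin n)).sum_comp, Fintype.sum_prod_type]
          refine Finset.sum_congr rfl fun i _ => ?_
          rw [Finset.mul_sum]
          refine Finset.sum_congr rfl fun s _ => ?_
          rw [List.ofFn_succ']
          simp only [Fin.snocEquiv, Equiv.coe_fn_mk, Fin.snoc_castSucc, Fin.snoc_last,
            List.concat_eq_append, pderivList_append_single, Fin.prod_univ_castSucc]
          ring

lemma dirDeriv_eq {n : ℕ} (F : MvPolynomial (Fin n) k) (v w : Fin n → k) (m : ℕ) :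
    dirDeriv F v w m = (m.factorial : k) * eval w ((tay v F).coeff m) := by
  have := congrArg (eval w) (tay_coeff_formula v m F)
  simp only [map_mul, map_natCast, map_sum, eval_C, map_prod, eval_X] at this
  rw [this, dirDeriv]

lemma hasMultiplicityAt_iff [CharZero k] {n : ℕ} (F : MvPolynomial (Fin n) k) (v : Fin n → k) (m : ℕ) :
    HasMultiplicityAt F v m ↔ (∀ j < m, (tay v F).coeff j = 0) ∧ (tay v F).coeff m ≠ 0 := by
  constructor
  · rintro ⟨h1, s, hs, hs'⟩
    refine ⟨fun j hj => ?_, fun h => hs' (eval_pderivList_of_coeff v s F (hs ▸ h))⟩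
    have := tay_coeff_formula v j F
    rw [Finset.sum_eq_zero] at this
    · rcases mul_eq_zero.1 this with h | h
      · exact absurd h (by exact_mod_cast j.factorial_ne_zero)
      · exact h
    · intro s _
      rw [h1 _ (by simpa using hj)]; simp
  · rintro ⟨h1, h2⟩
    refine ⟨fun s hs => eval_pderivList_of_coeff v s F (h1 _ hs), ?_⟩
    by_contra! hc
    have := tay_coeff_formula v m F
    rw [Finset.sum_eq_zero] at this
    · rcases mul_eq_zero.1 this with h | h
      · exact absurd h (by exact_mod_cast m.factorial_ne_zero)
      · exact h2 h
    · intro s _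
      rw [hc _ (by simp)]; simp

lemma isSingularAt_iff [CharZero k] (F : MvPolynomial (Fin 3) k) (v : Fin 3 → k) :
    IsSingularAt F v ↔ v ≠ 0 ∧ Polynomial.X ^ 2 ∣ tay v F := by
  rw [Polynomial.X_pow_dvd_iff, IsSingularAt]
  refine and_congr_right fun hv => ?_
  constructor
  · rintro ⟨h1, h2⟩ d hd
    interval_cases d
    · rw [tay_coeff_zero, h1, C_0]
    · have := tay_coeff_formula v 1 F
      rw [Finset.sum_eq_zero] at this
      · simpa using this
      · intro s _
        simp [pderivList, h2]
  · intro h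
    have h0 := h 0 (by norm_num)
    have h1 := h 1 (by norm_num)
    refine ⟨?_, fun i => ?_⟩
    · exact eval_pderivList_of_coeff v [] F h0
    · exact eval_pderivList_of_coeff v [i] F h1

/-- A form that is a product of `m` pairwise non-proportional linear forms. -/
def DistinctLines (m : ℕ) (H : MvPolynomial (Fin 3) k) : Prop :=
  ∃ (c : k) (L : Fin m → (Fin 3 → k)), c ≠ 0 ∧
      (∀ i j, i ≠ j → ¬ ∃ t : k, L j = t • L i) ∧
      H = C c * ∏ i, (∑ j, C (L i j) * X j)

lemma isOrdinaryAt_iff [CharZero k] (F : MvPolynomial (Fin 3) k) (v : Fin 3 → k) (m : ℕ)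
    (h : HasMultiplicityAt F v m) :
    IsOrdinaryAt F v m ↔ DistinctLines m ((tay v F).coeff m) := by
  have hm : (m.factorial : k) ≠ 0 := by exact_mod_cast m.factorial_ne_zero
  constructor
  · rintro ⟨-, c, L, hc, hL, hw⟩
    refine ⟨(m.factorial : k)⁻¹ * c, L, by simp [hm, hc], hL, ?_⟩
    apply MvPolynomial.funext
    intro w
    have := hw w
    rw [dirDeriv_eq] at this
    simp only [map_mul, eval_C, map_prod, map_sum, eval_X]
    rw [mul_assoc, ← this]
    field_simp
  · rintro ⟨c, L, hc, hL, hw⟩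
    refine ⟨h, m.factorial * c, L, by simp [hm, hc], hL, fun w => ?_⟩
    rw [dirDeriv_eq, hw]
    simp only [map_mul, eval_C, map_prod, map_sum, eval_X]
    ring

lemma tay_coeff_homog {n : ℕ} (v : Fin n → k) (F : MvPolynomial (Fin n) k) (j : ℕ) :
    ((tay v F).coeff j).IsHomogeneous j := by
  induction F using MvPolynomial.induction_on generalizing j with
  | C a =>
    rw [tay_C, Polynomial.coeff_C]
    split_ifs with h
    · subst h; exact isHomogeneous_C _ _
    · exact isHomogeneous_zero _ _ _
  | add p q hp hq => simpa using (hp j).add (hq j)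
  | mul_X p l hp =>
    rw [map_mul, tay_X, mul_add, Polynomial.coeff_add, Polynomial.coeff_mul_C, ← mul_assoc,
      Polynomial.coeff_mul_C, mul_comm (tay v p) Polynomial.X]
    refine IsHomogeneous.add ?_ ?_
    · simpa using (hp j).mul (isHomogeneous_C _ (v l))
    · cases j with
      | zero => simpa using isHomogeneous_zero _ _ _
      | succ j =>
        rw [Polynomial.coeff_X_mul]
        exact (hp j).mul (isHomogeneous_X _ l)


lemma coeff_zero_eval₂_X {R S : Type} [CommRing R] [CommRing S] (f : R →+* Polynomial S)
    (g : Polynomial R) : (Polynomial.eval₂ f Polynomial.X g).coeff 0 = (f (g.coeff 0)).coeff 0 := by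
  conv_lhs => rw [← Polynomial.divX_mul_X_add g]
  simp [Polynomial.eval₂_add, Polynomial.eval₂_mul]

lemma aeval_eq_eval₂_tay {n m : ℕ} (w : Fin n → k) (q : Fin n → Polynomial (MvPolynomial (Fin m) k))
    (F : MvPolynomial (Fin n) k) :
    aeval (fun i => Polynomial.C (C (w i)) + Polynomial.X * q i) F =
      Polynomial.eval₂ (aeval q : MvPolynomial (Fin n) k →ₐ[k] _).toRingHom Polynomial.X (tay w F) := by
  induction F using MvPolynomial.induction_on with
  | C a => simp [tay_C, Polynomial.algebraMap_apply, algebraMap_eq]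
  | add p q hp hq => rw [map_add, map_add, Polynomial.eval₂_add, hp, hq]
  | mul_X p l hp =>
    rw [map_mul, map_mul, Polynomial.eval₂_mul, hp, tay_X]
    congr 1
    simp [Polynomial.eval₂_add, Polynomial.eval₂_mul, Polynomial.algebraMap_apply, algebraMap_eq]
    ring

lemma tay_bind₁ {n m : ℕ} (v : Fin m → k) (φ : Fin n → MvPolynomial (Fin m) k)
    (F : MvPolynomial (Fin n) k) : tay v (bind₁ φ F) = aeval (fun i => tay v (φ i)) F := by
  rw [bind₁, ← AlgHom.comp_apply, comp_aeval]

lemma tay_comp {n m : ℕ} (w : Fin n → k) (v : Fin m → k) (φ : Fin n → MvPolynomial (Fin m) k)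
    (q : Fin n → Polynomial (MvPolynomial (Fin m) k))
    (hq : ∀ i, tay v (φ i) = Polynomial.C (C (w i)) + Polynomial.X * q i)
    (F : MvPolynomial (Fin n) k) (r : ℕ) (h : Polynomial.X ^ r ∣ tay w F) :
    Polynomial.X ^ r ∣ tay v (bind₁ φ F) ∧
      (tay v (bind₁ φ F)).coeff r = bind₁ (fun i => (q i).coeff 0) ((tay w F).coeff r) := by
  have h1 : tay v (bind₁ φ F) = Polynomial.eval₂ (aeval q : MvPolynomial (Fin n) k →ₐ[k] _).toRingHom Polynomial.X (tay w F) := by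
    rw [tay_bind₁, ← aeval_eq_eval₂_tay]
    simp only [hq]
  obtain ⟨g, hg⟩ := h
  rw [h1, hg, Polynomial.eval₂_mul, Polynomial.eval₂_pow, Polynomial.eval₂_X]
  refine ⟨dvd_mul_right _ _, ?_⟩
  have e1 : ∀ {R : Type} [CommRing R] (p : Polynomial R), (Polynomial.X ^ r * p).coeff r = p.coeff 0 := by
    intro R _ p
    simpa using Polynomial.coeff_X_pow_mul p r 0
  rw [e1, e1, coeff_zero_eval₂_X]
  generalize g.coeff 0 = a
  have : (Polynomial.constantCoeff : Polynomial (MvPolynomial (Fin m) k) →+* _).comp (aeval q : MvPolynomial (Fin n) k →ₐ[k] _).toRingHom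
      = (bind₁ (fun i => (q i).coeff 0) : MvPolynomial (Fin n) k →ₐ[k] _).toRingHom := by
    apply MvPolynomial.ringHom_ext
    · intro a; simp [Polynomial.algebraMap_apply, algebraMap_eq]
    · intro i; simp
  exact congrArg (fun f => f a) this

lemma tay_ne_zero {n : ℕ} (v : Fin n → k) {F : MvPolynomial (Fin n) k} (hF : F ≠ 0) : tay v F ≠ 0 := by
  intro h
  apply hF
  have h1 : bind₁ (fun i => X i - C (v i)) (Polynomial.eval 1 (tay v F)) = F := by
    have : ((bind₁ (fun i => X i - C (v i)) : MvPolynomial (Fin n) k →ₐ[k] MvPolynomial (Fin n) k).toRingHom.comp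
      ((Polynomial.evalRingHom 1).comp (tay v).toRingHom)) = RingHom.id _ := by
      apply MvPolynomial.ringHom_ext
      · intro a; simp [tay_C, -algHom_C]; exact bind₁_C_right _ _
      · intro i; simp [tay_X]
    exact congrArg (fun f => f F) this
  rw [← h1, h]; simp

lemma exists_order {n : ℕ} (v : Fin n → k) {F : MvPolynomial (Fin n) k} (hF : F ≠ 0) :
    ∃ m, Polynomial.X ^ m ∣ tay v F ∧ (tay v F).coeff m ≠ 0 := by
  classical
  have h : ∃ m, (tay v F).coeff m ≠ 0 := by
    by_contra! hc
    exact tay_ne_zero v hF (Polynomial.ext (by simpa using hc))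
  refine ⟨Nat.find h, ?_, Nat.find_spec h⟩
  rw [Polynomial.X_pow_dvd_iff]
  intro d hd
  simpa using Nat.find_min h hd

lemma order_le {R : Type} [CommRing R] {p : Polynomial R} {m j : ℕ} (h : Polynomial.X ^ m ∣ p) (hj : p.coeff j ≠ 0) :
    m ≤ j := by
  by_contra! hc
  exact hj (Polynomial.X_pow_dvd_iff.1 h j hc)

/-- `v` is a non-ordinary singular point of `F = 0`. -/
def NonOrd (F : MvPolynomial (Fin 3) k) (v : Fin 3 → k) : Prop :=
  v ≠ 0 ∧ Polynomial.X ^ 2 ∣ tay v F ∧ ∃ m, Polynomial.X ^ m ∣ tay v F ∧ (tay v F).coeff m ≠ 0 ∧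
    ¬ DistinctLines m ((tay v F).coeff m)

lemma linMap_eval (A : Matrix.GeneralLinearGroup (Fin 3) k) (v : Fin 3 → k) (i : Fin 3) :
    eval v (linMap A i) = ((A : Matrix (Fin 3) (Fin 3) k).mulVec v) i := by
  simp [linMap, Matrix.mulVec, dotProduct]

lemma bind₁_linMap_linMap (A B : Matrix.GeneralLinearGroup (Fin 3) k) (i : Fin 3) :
    bind₁ (linMap A) (linMap B i) = linMap (B * A) i := by
  simp only [linMap, map_sum, map_mul, bind₁_C_right, bind₁_X_right, Units.val_mul, Matrix.mul_apply,
    Finset.mul_sum, Finset.sum_mul]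
  rw [Finset.sum_comm]
  simp only [mul_assoc]

lemma bind₁_linMap_mul (A B : Matrix.GeneralLinearGroup (Fin 3) k) (F : MvPolynomial (Fin 3) k) :
    bind₁ (linMap A) (bind₁ (linMap B) F) = bind₁ (linMap (B * A)) F := by
  rw [bind₁_bind₁]
  simp only [bind₁_linMap_linMap]

lemma linMap_one : linMap (1 : Matrix.GeneralLinearGroup (Fin 3) k) = X := by
  ext1 i
  simp [linMap, Matrix.one_apply]

lemma bind₁_linMap_one (F : MvPolynomial (Fin 3) k) :
    bind₁ (linMap (1 : Matrix.GeneralLinearGroup (Fin 3) k)) F = F := by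
  rw [linMap_one]; simp

/-- Linear substitution as an algebra automorphism. -/
noncomputable def linEquiv (A : Matrix.GeneralLinearGroup (Fin 3) k) :
    MvPolynomial (Fin 3) k ≃ₐ[k] MvPolynomial (Fin 3) k :=
  AlgEquiv.ofAlgHom (bind₁ (linMap A)) (bind₁ (linMap A⁻¹))
    (by ext1 i; simp [bind₁_linMap_linMap, linMap_one])
    (by ext1 i; simp [bind₁_linMap_linMap, linMap_one])

lemma linEquiv_apply (A : Matrix.GeneralLinearGroup (Fin 3) k) (F : MvPolynomial (Fin 3) k) :
    linEquiv A F = bind₁ (linMap A) F := rfl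

lemma irreducible_lin (A : Matrix.GeneralLinearGroup (Fin 3) k) {F : MvPolynomial (Fin 3) k}
    (h : Irreducible F) : Irreducible (bind₁ (linMap A) F) := by
  rw [← linEquiv_apply]
  exact (MulEquiv.irreducible_iff (linEquiv A)).2 h

lemma linMap_homog (A : Matrix.GeneralLinearGroup (Fin 3) k) (i : Fin 3) : (linMap A i).IsHomogeneous 1 := by
  apply IsHomogeneous.sum
  intro j _
  exact isHomogeneous_C_mul_X _ _

lemma homog_lin (A : Matrix.GeneralLinearGroup (Fin 3) k) {F : MvPolynomial (Fin 3) k} {n : ℕ}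
    (h : F.IsHomogeneous n) : (bind₁ (linMap A) F).IsHomogeneous n := by
  have := h.aeval (linMap A) (linMap_homog A)
  rw [one_mul] at this
  exact this

lemma distinctLines_lin {m : ℕ} {H : MvPolynomial (Fin 3) k} (h : DistinctLines m H)
    (A : Matrix.GeneralLinearGroup (Fin 3) k) (a : k) (ha : a ≠ 0) :
    DistinctLines m (C a * bind₁ (linMap A) H) := by
  obtain ⟨c, L, hc, hL, rfl⟩ := h
  refine ⟨a * c, fun i => Matrix.vecMul (L i) (A : Matrix (Fin 3) (Fin 3) k), by simp [ha, hc], ?_, ?_⟩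
  · rintro i j hij ⟨t, ht⟩
    apply hL i j hij
    refine ⟨t, ?_⟩
    have := congrArg (fun w => Matrix.vecMul w ((A⁻¹ : Matrix.GeneralLinearGroup (Fin 3) k) : Matrix (Fin 3) (Fin 3) k)) ht
    simp only [Matrix.smul_vecMul, Matrix.vecMul_vecMul, ← Units.val_mul, mul_inv_cancel, Units.val_one, Matrix.vecMul_one] at this
    exact this
  · rw [map_mul, map_prod, bind₁_C_right, C_mul, mul_assoc]
    congr 2
    refine Finset.prod_congr rfl fun i _ => ?_
    simp only [map_sum, map_mul, bind₁_C_right, bind₁_X_right, linMap, Matrix.vecMul, dotProduct,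
      Finset.sum_mul, Finset.mul_sum]
    rw [Finset.sum_comm]
    simp only [mul_assoc]

/-- Local comparison of `F` at `w` with `G` at `v` through an invertible linear map. -/
def LocEq (F : MvPolynomial (Fin 3) k) (w : Fin 3 → k) (G : MvPolynomial (Fin 3) k) (v : Fin 3 → k) : Prop :=
  ∃ (A : Matrix.GeneralLinearGroup (Fin 3) k) (a : k), a ≠ 0 ∧ ∀ m, Polynomial.X ^ m ∣ tay w F →
    Polynomial.X ^ m ∣ tay v G ∧ (tay v G).coeff m = C a * bind₁ (linMap A) ((tay w F).coeff m)

lemma LocEq.trans {F G H : MvPolynomial (Fin 3) k} {u v w : Fin 3 → k} (h1 : LocEq F u G v) (h2 : LocEq G v H w) :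
    LocEq F u H w := by
  obtain ⟨A, a, ha, h1⟩ := h1
  obtain ⟨B, b, hb, h2⟩ := h2
  refine ⟨A * B, b * a, mul_ne_zero hb ha, fun m hm => ?_⟩
  obtain ⟨h3, h4⟩ := h1 m hm
  obtain ⟨h5, h6⟩ := h2 m h3
  refine ⟨h5, ?_⟩
  rw [h6, h4, map_mul, bind₁_C_right, bind₁_linMap_mul, C_mul, mul_assoc]

lemma LocEq.coeff_ne {F G : MvPolynomial (Fin 3) k} {v w : Fin 3 → k} (h : LocEq F w G v) {m : ℕ}
    (h1 : Polynomial.X ^ m ∣ tay w F) (h2 : (tay w F).coeff m ≠ 0) :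
    Polynomial.X ^ m ∣ tay v G ∧ (tay v G).coeff m ≠ 0 := by
  obtain ⟨A, a, ha, h⟩ := h
  obtain ⟨h3, h4⟩ := h m h1
  refine ⟨h3, ?_⟩
  rw [h4]
  refine mul_ne_zero (by simpa using ha) ?_
  rw [← linEquiv_apply]
  simpa using h2

lemma LocEq.dvd {F G : MvPolynomial (Fin 3) k} {v w : Fin 3 → k} (h : LocEq F w G v) (hF : F ≠ 0) (m : ℕ) :
    Polynomial.X ^ m ∣ tay w F ↔ Polynomial.X ^ m ∣ tay v G := by
  constructor
  · obtain ⟨A, a, ha, h⟩ := h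
    exact fun h1 => (h m h1).1
  · intro h1
    obtain ⟨d, hd, hd'⟩ := exists_order w hF
    have h2 := h.coeff_ne hd hd'
    exact (pow_dvd_pow _ (order_le h1 h2.2)).trans hd

lemma LocEq.nonOrd {F G : MvPolynomial (Fin 3) k} {v w : Fin 3 → k} (h : LocEq F w G v) (hF : F ≠ 0) (hw : w ≠ 0)
    (hG : NonOrd G v) : NonOrd F w := by
  obtain ⟨-, h2, m, h3, h4, h5⟩ := hG
  refine ⟨hw, (h.dvd hF 2).2 h2, m, (h.dvd hF m).2 h3, ?_, ?_⟩
  · obtain ⟨d, hd, hd'⟩ := exists_order w hF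
    have h6 := h.coeff_ne hd hd'
    have : m = d := le_antisymm (order_le h3 h6.2) (order_le h6.1 h4)
    rwa [this]
  · intro h6
    apply h5
    have h7 := (h.dvd hF m).2 h3
    obtain ⟨A, a, ha, h⟩ := h
    rw [(h m h7).2]
    exact distinctLines_lin h6 A a ha

lemma tay_linMap (A : Matrix.GeneralLinearGroup (Fin 3) k) (v : Fin 3 → k) (i : Fin 3) :
    tay v (linMap A i) = Polynomial.C (C (((A : Matrix (Fin 3) (Fin 3) k).mulVec v) i)) +
      Polynomial.X * Polynomial.C (linMap A i) := by
  simp only [linMap, map_sum, map_mul, tay_X, tay_C, Matrix.mulVec, dotProduct, mul_add, Finset.sum_add_distrib,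
    Finset.mul_sum]
  refine congrArg₂ (· + ·) rfl (Finset.sum_congr rfl fun j _ => by ring)

lemma locEq_lin (A : Matrix.GeneralLinearGroup (Fin 3) k) (F : MvPolynomial (Fin 3) k) (v : Fin 3 → k) :
    LocEq F ((A : Matrix (Fin 3) (Fin 3) k).mulVec v) (bind₁ (linMap A) F) v := by
  refine ⟨A, 1, one_ne_zero, fun m hm => ?_⟩
  have := tay_comp ((A : Matrix (Fin 3) (Fin 3) k).mulVec v) v (linMap A) (fun i => Polynomial.C (linMap A i))
    (fun i => tay_linMap A v i) F m hm
  refine ⟨this.1, ?_⟩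
  rw [this.2, C_1, one_mul]
  simp only [Polynomial.coeff_C_zero]

lemma homog_bind_scale {m n : ℕ} {F : MvPolynomial (Fin m) k} (h : F.IsHomogeneous n) {R : Type} [CommRing R] [Algebra k R]
    (c : R) (q : Fin m → R) : aeval (fun i => c * q i) F = c ^ n * aeval q F := by
  have h2 : ∀ f : Fin m → R, aeval f F = ∑ d ∈ F.support, algebraMap k R (F.coeff d) * ∏ i, f i ^ d i := by
    intro f
    rw [aeval_def, eval₂_eq']
  rw [h2, h2, Finset.mul_sum]
  refine Finset.sum_congr rfl fun d hd => ?_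
  simp only [mul_pow, Finset.prod_mul_distrib, Finset.prod_pow_eq_pow_sum]
  have h3 := h.degree_eq_sum_deg_support hd
  have h4 : ∑ i, d i = n := by
    rw [h3]; exact (Finsupp.sum_fintype d (fun _ e => e) (by simp)).symm
  rw [h4]; ring

lemma locEq_scale {F : MvPolynomial (Fin 3) k} {n : ℕ} (h : F.IsHomogeneous n) (v : Fin 3 → k) (c : k) (hc : c ≠ 0) :
    LocEq F v F (c • v) := by
  have hc' : c⁻¹ ≠ 0 := inv_ne_zero hc
  let A : Matrix.GeneralLinearGroup (Fin 3) k :=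
    ⟨c⁻¹ • 1, c • 1, by simp [hc], by simp [hc]⟩
  have hA : ∀ i, linMap A i = C c⁻¹ * X i := by
    intro i
    simp only [linMap, A]
    rw [Finset.sum_eq_single i]
    · simp
    · intro b _ hb
      simp [Matrix.one_apply, hb.symm]
    · simp
  have h1 := locEq_lin A F (c • v)
  have h2 : (A : Matrix (Fin 3) (Fin 3) k).mulVec (c • v) = v := by
    simp [A, Matrix.smul_mulVec, hc]
  rw [h2] at h1
  have h3 : bind₁ (linMap A) F = C (c⁻¹ ^ n) * F := by
    have : linMap A = fun i => C c⁻¹ * X i := by ext1 i; exact hA i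
    rw [this]
    have := homog_bind_scale h (C c⁻¹ : MvPolynomial (Fin 3) k) X
    rw [aeval_X_left_apply] at this
    rw [C_pow]
    exact this
  rw [h3] at h1
  refine h1.trans ⟨1, c ^ n, pow_ne_zero _ hc, fun m hm => ?_⟩
  have h4 : tay (c • v) F = Polynomial.C (C (c ^ n)) * tay (c • v) (C (c⁻¹ ^ n) * F) := by
    rw [map_mul, tay_C, ← mul_assoc, ← Polynomial.C_mul, ← C_mul]
    simp [← mul_pow, hc]
  rw [bind₁_linMap_one]
  constructor
  · rw [h4]; exact Dvd.dvd.mul_left hm _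
  · conv_lhs => rw [h4]
    rw [Polynomial.coeff_C_mul]


lemma tri_add (x y : ℕ) : (x + y + 1).choose 2 = (x + 1).choose 2 + (y + 1).choose 2 + x * y := by
  induction y with
  | zero => simp
  | succ y ih =>
    have h1 : (x + (y + 1) + 1).choose 2 = (x + y + 1).choose 1 + (x + y + 1).choose 2 := Nat.choose_succ_succ _ _
    have h2 : (y + 1 + 1).choose 2 = (y + 1).choose 1 + (y + 1).choose 2 := Nat.choose_succ_succ _ _
    rw [h1, h2, ih]; simp; ring

lemma tri_two (x : ℕ) : 2 * (x + 1).choose 2 = x * (x + 1) := by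
  induction x with
  | zero => simp
  | succ y ih =>
    have h2 : (y + 1 + 1).choose 2 = (y + 1).choose 1 + (y + 1).choose 2 := Nat.choose_succ_succ _ _
    rw [h2, mul_add, ih]; simp; ring

/-- The coefficients along a finite set of exponents. -/
noncomputable def coeffMap {σ : Type} (S : Finset (σ →₀ ℕ)) : MvPolynomial σ k →ₗ[k] (S → k) :=
  LinearMap.pi (fun d => MvPolynomial.lcoeff k d.1)

lemma coeffMap_apply {σ : Type} (S : Finset (σ →₀ ℕ)) (F : MvPolynomial σ k) (d : S) :
    coeffMap S F d = F.coeff d.1 := rfl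

lemma coeffMap_lift {σ : Type} (S : Finset (σ →₀ ℕ)) (y : S → k) :
    coeffMap S (∑ d : S, monomial d.1 (y d)) = y := by
  classical
  ext e
  rw [coeffMap_apply, coeff_sum]
  rw [Finset.sum_eq_single e]
  · simp
  · intro b _ hb
    rw [coeff_monomial, if_neg]
    intro h; exact hb (Subtype.ext h)
  · simp

lemma mem_antidiag_iff {m : ℕ} (e : Fin m →₀ ℕ) (d : ℕ) :
    e ∈ Finset.finsuppAntidiag Finset.univ d ↔ e.degree = d := by
  simp [Finset.mem_finsuppAntidiag, Finsupp.degree_eq_sum]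

lemma finrank_homog (d : ℕ) :
    Module.finrank k (homogeneousSubmodule (Fin 3) k d) = (d + 2).choose 2 := by
  set S := Finset.finsuppAntidiag (Finset.univ : Finset (Fin 3)) d
  have e : homogeneousSubmodule (Fin 3) k d ≃ₗ[k] (S → k) := by
    refine LinearEquiv.ofBijective ((coeffMap S).domRestrict _) ⟨?_, ?_⟩
    · rw [← LinearMap.ker_eq_bot, LinearMap.ker_eq_bot']
      rintro ⟨F, hF⟩ h
      ext e
      by_cases he : e.degree = d
      · exact congrFun h ⟨e, (mem_antidiag_iff _ _).2 he⟩
      · exact IsHomogeneous.coeff_eq_zero hF he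
    · intro y
      refine ⟨⟨∑ d : S, monomial d.1 (y d), ?_⟩, coeffMap_lift S y⟩
      apply IsHomogeneous.sum
      intro e _
      exact isHomogeneous_monomial _ ((mem_antidiag_iff _ _).1 e.2)
  rw [e.finrank_eq, Module.finrank_fintype_fun_eq_card, Fintype.card_coe,
    Finset.card_finsuppAntidiag_nat_eq_choose]
  simp only [Finset.card_univ, Fintype.card_fin]
  rw [show 3 + d - 1 = d + 2 by omega, ← Nat.choose_symm_add]

instance (d : ℕ) : FiniteDimensional k (homogeneousSubmodule (Fin 3) k d) :=
  Module.finite_of_finrank_pos (by rw [finrank_homog]; exact Nat.choose_pos (by omega))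

/-- The maximal ideal of a point of the affine plane. -/
noncomputable def mI (p : Fin 2 → k) : Ideal (MvPolynomial (Fin 2) k) :=
  Ideal.span (Set.range fun i => X i - C (p i))

/-- Translation of the affine plane. -/
noncomputable def transEquiv (p : Fin 2 → k) : MvPolynomial (Fin 2) k ≃ₐ[k] MvPolynomial (Fin 2) k :=
  AlgEquiv.ofAlgHom (aeval fun i => X i - C (p i)) (aeval fun i => X i + C (p i))
    (by ext1 i; simp [← algebraMap_eq]) (by ext1 i; simp [← algebraMap_eq])

lemma mI_pow_eq (p : Fin 2 → k) (s : ℕ) :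
    mI p ^ s = (idealOfVars (Fin 2) k ^ s).map (transEquiv p : MvPolynomial (Fin 2) k →+* MvPolynomial (Fin 2) k) := by
  rw [Ideal.map_pow]
  congr 1
  rw [idealOfVars, Ideal.map_span, ← Set.range_comp, mI]
  congr 2
  ext1 i
  simp [transEquiv]

noncomputable def quotOriginEquiv (s : ℕ) :
    (MvPolynomial (Fin 2) k ⧸ (idealOfVars (Fin 2) k ^ s)) ≃ₗ[k]
      ((Finset.range s).biUnion fun i => Finset.finsuppAntidiag (Finset.univ : Finset (Fin 2)) i) → k := by
  have hker : LinearMap.ker (coeffMap (k := k) ((Finset.range s).biUnion fun i => Finset.finsuppAntidiag (Finset.univ : Finset (Fin 2)) i))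
      = (idealOfVars (Fin 2) k ^ s).restrictScalars k := by
    ext F
    rw [LinearMap.mem_ker, Submodule.restrictScalars_mem, mem_pow_idealOfVars_iff']
    constructor
    · intro h x hx
      refine congrFun h ⟨x, ?_⟩
      simp only [Finset.mem_biUnion, Finset.mem_range, mem_antidiag_iff]
      exact ⟨_, hx, rfl⟩
    · intro h
      ext ⟨x, hx⟩
      simp only [Finset.mem_biUnion, Finset.mem_range, mem_antidiag_iff] at hx
      obtain ⟨a, ha, rfl⟩ := hx
      exact h x ha
  have hsurj : Function.Surjective (coeffMap (k := k) ((Finset.range s).biUnion fun i => Finset.finsuppAntidiag (Finset.univ : Finset (Fin 2)) i)) :=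
    fun y => ⟨_, coeffMap_lift _ y⟩
  exact ((Submodule.Quotient.restrictScalarsEquiv k _).symm.trans
    (Submodule.quotEquivOfEq _ _ hker.symm)).trans (LinearMap.quotKerEquivOfSurjective _ hsurj)

lemma card_lt_degree (s : ℕ) :
    ((Finset.range s).biUnion fun i => Finset.finsuppAntidiag (Finset.univ : Finset (Fin 2)) i).card = (s + 1).choose 2 := by
  rw [Finset.card_biUnion]
  · simp only [Finset.card_finsuppAntidiag_nat_eq_choose, Finset.card_univ, Fintype.card_fin]
    induction s with
    | zero => simp
    | succ s ih =>
      rw [Finset.sum_range_succ, ih, show 2 + s - 1 = s + 1 by omega]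
      have h1 : (s + 1 + 1).choose 2 = (s + 1).choose 1 + (s + 1).choose 2 := Nat.choose_succ_succ _ _
      rw [h1]; simp; ring
  · intro i _ j _ hij
    change Disjoint _ _
    rw [Finset.disjoint_left]
    intro x hx hy
    rw [mem_antidiag_iff] at hx hy
    exact hij (hx.symm.trans hy)

noncomputable def quotEquiv (p : Fin 2 → k) (s : ℕ) :
    (MvPolynomial (Fin 2) k ⧸ (mI p ^ s)) ≃ₗ[k]
      ((Finset.range s).biUnion fun i => Finset.finsuppAntidiag (Finset.univ : Finset (Fin 2)) i) → k :=
  (Ideal.quotientEquivAlg _ _ (transEquiv p) (mI_pow_eq p s)).symm.toLinearEquiv.trans (quotOriginEquiv s)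

instance (p : Fin 2 → k) (s : ℕ) : FiniteDimensional k (MvPolynomial (Fin 2) k ⧸ (mI p ^ s)) :=
  Module.Finite.equiv (quotEquiv p s).symm

lemma finrank_quot (p : Fin 2 → k) (s : ℕ) :
    Module.finrank k (MvPolynomial (Fin 2) k ⧸ (mI p ^ s)) = (s + 1).choose 2 := by
  rw [(quotEquiv p s).finrank_eq, Module.finrank_fintype_fun_eq_card, Fintype.card_coe, card_lt_degree]

lemma mI_coprime {p q : Fin 2 → k} (h : p ≠ q) (a b : ℕ) : IsCoprime (mI p ^ a) (mI q ^ b) := by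
  apply IsCoprime.pow
  obtain ⟨i, hi⟩ := Function.ne_iff.1 h
  rw [Ideal.isCoprime_iff_exists]
  refine ⟨-(C (p i - q i)⁻¹ * (X i - C (p i))), ?_, C (p i - q i)⁻¹ * (X i - C (q i)), ?_, ?_⟩
  · exact neg_mem (Ideal.mul_mem_left _ _ (Ideal.subset_span ⟨i, rfl⟩))
  · exact Ideal.mul_mem_left _ _ (Ideal.subset_span ⟨i, rfl⟩)
  · have : (p i - q i) ≠ 0 := sub_ne_zero.2 hi
    rw [← sub_eq_neg_add, ← mul_sub]
    rw [show (X i - C (q i) - (X i - C (p i)) : MvPolynomial (Fin 2) k) = C (p i - q i) by rw [C_sub]; ring, ← C_mul,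
      inv_mul_cancel₀ this, C_1]

/-- Dehomogenization. -/
noncomputable def dehom : MvPolynomial (Fin 3) k →ₐ[k] MvPolynomial (Fin 2) k :=
  aeval ![X 0, X 1, 1]

lemma exists_homogenization (g : MvPolynomial (Fin 2) k) (d : ℕ) (hd : g.totalDegree ≤ d) :
    ∃ G ∈ homogeneousSubmodule (Fin 3) k d, dehom G = g := by
  refine ⟨∑ e ∈ g.support, C (g.coeff e) * (X 0 ^ e 0 * X 1 ^ e 1 * X 2 ^ (d - e 0 - e 1)), ?_, ?_⟩
  · apply IsHomogeneous.sum
    intro e he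
    have h1 := le_totalDegree he
    have h2 : (e.sum fun _ a => a) = e 0 + e 1 := by
      rw [Finsupp.sum_fintype _ _ (by simp)]; simp
    have := ((((isHomogeneous_X k (0 : Fin 3)).pow (e 0)).mul ((isHomogeneous_X k (1 : Fin 3)).pow (e 1))).mul ((isHomogeneous_X k (2 : Fin 3)).pow (d - e 0 - e 1))).C_mul (g.coeff e)
    convert this using 1
    omega
  · conv_rhs => rw [g.as_sum]
    rw [map_sum]
    refine Finset.sum_congr rfl fun e he => ?_
    rw [monomial_eq, Finsupp.prod_fintype _ _ (by simp)]
    simp [dehom, algebraMap_eq]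

lemma aeval_mem_pow {m j : ℕ} {H : MvPolynomial (Fin m) k} (hH : H.IsHomogeneous j) {R : Type} [CommRing R]
    [Algebra k R] (I : Ideal R) (q : Fin m → R) (hq : ∀ i, q i ∈ I) : aeval q H ∈ I ^ j := by
  rw [aeval_def, eval₂_eq']
  refine Ideal.sum_mem _ fun d hd => Ideal.mul_mem_left _ _ ?_
  have h4 : ∑ i, d i = j := by
    rw [hH.degree_eq_sum_deg_support hd]; exact (Finsupp.sum_fintype d (fun _ e => e) (by simp)).symm
  rw [← h4, ← Finset.prod_pow_eq_pow_sum]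
  exact Ideal.prod_mem_prod fun i _ => Ideal.pow_mem_pow (hq i) _

lemma bind_eval_tay {n : ℕ} (v : Fin n → k) (F : MvPolynomial (Fin n) k) :
    bind₁ (fun i => X i - C (v i)) (Polynomial.eval 1 (tay v F)) = F := by
  have : ((bind₁ (fun i => X i - C (v i)) : MvPolynomial (Fin n) k →ₐ[k] MvPolynomial (Fin n) k).toRingHom.comp
    ((Polynomial.evalRingHom 1).comp (tay v).toRingHom)) = RingHom.id _ := by
    apply MvPolynomial.ringHom_ext
    · intro a; simp [tay_C, -algHom_C]; exact bind₁_C_right _ _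
    · intro i; simp [tay_X]
  exact congrArg (fun f => f F) this

lemma dehom_mem (F : MvPolynomial (Fin 3) k) (p : Fin 2 → k) (r : ℕ)
    (h : Polynomial.X ^ r ∣ tay ![p 0, p 1, 1] F) : dehom F ∈ mI p ^ r := by
  rw [← bind_eval_tay ![p 0, p 1, 1] F, Polynomial.eval_eq_sum_range, map_sum, map_sum]
  refine Ideal.sum_mem _ fun j _ => ?_
  rw [one_pow, mul_one]
  by_cases hj : j < r
  · rw [Polynomial.X_pow_dvd_iff.1 h j hj]; simp
  · have h1 : dehom (bind₁ (fun i => X i - C ((![p 0, p 1, 1] : Fin 3 → k) i)) ((tay ![p 0, p 1, 1] F).coeff j)) =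
        aeval (fun i => dehom (X i - C ((![p 0, p 1, 1] : Fin 3 → k) i))) ((tay ![p 0, p 1, 1] F).coeff j) := by
      rw [bind₁, ← AlgHom.comp_apply, comp_aeval]
    rw [h1]
    refine Ideal.pow_le_pow_right (not_lt.1 hj) (aeval_mem_pow (tay_coeff_homog _ _ _) _ _ ?_)
    intro i
    fin_cases i
    · simp only [dehom, map_sub, aeval_X, algHom_C, algebraMap_eq]
      exact Ideal.subset_span ⟨0, rfl⟩
    · simp only [dehom, map_sub, aeval_X, algHom_C, algebraMap_eq]
      exact Ideal.subset_span ⟨1, rfl⟩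
    · simp [dehom]


lemma homog_iff_tay {m : ℕ} (F : MvPolynomial (Fin m) k) (n : ℕ) :
    F.IsHomogeneous n ↔ tay 0 F = Polynomial.C F * Polynomial.X ^ n := by
  constructor
  · intro h
    have h1 := homog_bind_scale h (Polynomial.X : Polynomial (MvPolynomial (Fin m) k)) (fun i => Polynomial.C (X i))
    have h2 : tay 0 F = aeval (fun i => Polynomial.X * Polynomial.C (X i)) F := by
      unfold tay; refine congrArg (fun q => aeval q F) ?_; ext1 i; simp
    have h3 : (aeval (fun i => Polynomial.C (X i)) : MvPolynomial (Fin m) k →ₐ[k] Polynomial (MvPolynomial (Fin m) k)) F =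
        Polynomial.C F := by
      have : ((Polynomial.CAlgHom : MvPolynomial (Fin m) k →ₐ[MvPolynomial (Fin m) k] _).restrictScalars k) =
        (aeval (fun i => Polynomial.C (X i)) : MvPolynomial (Fin m) k →ₐ[k] Polynomial (MvPolynomial (Fin m) k)) := by
        ext1 i; simp
      rw [← this]; rfl
    rw [h2, h1, h3, mul_comm]
  · intro h
    have := tay_coeff_homog 0 F n
    rwa [h, Polynomial.coeff_C_mul, Polynomial.coeff_X_pow, if_pos rfl, mul_one] at this

lemma homog_cancel {m n c : ℕ} {F w : MvPolynomial (Fin m) k} (hF : F.IsHomogeneous n) (hF0 : F ≠ 0)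
    (h : (F * w).IsHomogeneous (n + c)) : w.IsHomogeneous c := by
  rw [homog_iff_tay] at *
  rw [map_mul, hF, Polynomial.C_mul, pow_add] at h
  have h0 : Polynomial.C F * Polynomial.X ^ n ≠ 0 :=
    mul_ne_zero (Polynomial.C_ne_zero.2 hF0) (pow_ne_zero _ Polynomial.X_ne_zero)
  apply mul_left_cancel₀ h0
  rw [h]; ring

lemma finrank_map_ineq {V W : Type} [AddCommGroup V] [Module k V] [FiniteDimensional k V] [AddCommGroup W] [Module k W]
    [FiniteDimensional k W] (f : V →ₗ[k] W) (hf : Function.Surjective f) (S : Submodule k V) :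
    Module.finrank k W + Module.finrank k S ≤ Module.finrank k (S.map f) + Module.finrank k V := by
  have h1 := S.finrank_quotient_add_finrank
  have h2 := (S.map f).finrank_quotient_add_finrank
  have h3 : Module.finrank k (W ⧸ S.map f) ≤ Module.finrank k (V ⧸ S) := by
    apply LinearMap.finrank_le_finrank_of_surjective (f := Submodule.mapQ S (S.map f) f (Submodule.le_comap_map f S))
    intro y
    obtain ⟨y, rfl⟩ := Submodule.Quotient.mk_surjective _ y
    obtain ⟨x, rfl⟩ := hf y
    exact ⟨Submodule.Quotient.mk x, rfl⟩
  omega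

lemma finrank_range_of_ker {V W U : Type} [AddCommGroup V] [Module k V] [FiniteDimensional k V] [AddCommGroup W] [Module k W]
    [FiniteDimensional k W] [AddCommGroup U] [Module k U] [FiniteDimensional k U] (S : V →ₗ[k] W) (T : V →ₗ[k] U)
    (h : LinearMap.ker S ≤ LinearMap.ker T) :
    Module.finrank k (LinearMap.range T) ≤ Module.finrank k W := by
  have h1 := S.finrank_range_add_finrank_ker
  have h2 := T.finrank_range_add_finrank_ker
  have h3 := Submodule.finrank_mono h
  have h4 := Submodule.finrank_le (LinearMap.range S)
  omega

/-- multiplication by a homogeneous polynomial on graded pieces -/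
noncomputable def mulH {n : ℕ} (F : MvPolynomial (Fin 3) k) (hF : F.IsHomogeneous n) (a d : ℕ) (h : n + a = d) :
    homogeneousSubmodule (Fin 3) k a →ₗ[k] homogeneousSubmodule (Fin 3) k d :=
  ((LinearMap.mulLeft k F).domRestrict _).codRestrict _ (by
    rintro ⟨x, hx⟩
    subst h
    exact hF.mul hx)

lemma mulH_coe {n : ℕ} (F : MvPolynomial (Fin 3) k) (hF : F.IsHomogeneous n) (a d : ℕ) (h : n + a = d)
    (x : homogeneousSubmodule (Fin 3) k a) : (mulH F hF a d h x : MvPolynomial (Fin 3) k) = F * x := rfl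

/-- evaluation in a product of local rings -/
noncomputable def locMap {ι : Type} (p : ι → Fin 2 → k) (e : ι → ℕ) :
    MvPolynomial (Fin 3) k →ₗ[k] (∀ i, MvPolynomial (Fin 2) k ⧸ (mI (p i) ^ (e i))) :=
  LinearMap.pi fun i => (Ideal.Quotient.mkₐ k _).toLinearMap ∘ₗ (dehom (k := k)).toLinearMap

lemma locMap_eq_zero {ι : Type} (p : ι → Fin 2 → k) (e : ι → ℕ) (F : MvPolynomial (Fin 3) k) :
    locMap p e F = 0 ↔ ∀ i, dehom F ∈ mI (p i) ^ (e i) := by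
  rw [funext_iff]
  refine forall_congr' fun i => ?_
  exact Ideal.Quotient.eq_zero_iff_mem

lemma finrank_loc {ι : Type} [Fintype ι] (p : ι → Fin 2 → k) (e : ι → ℕ) :
    Module.finrank k (∀ i, MvPolynomial (Fin 2) k ⧸ (mI (p i) ^ (e i))) = ∑ i, (e i + 1).choose 2 := by
  rw [Module.finrank_pi_fintype]
  exact Finset.sum_congr rfl fun i _ => finrank_quot _ _

lemma locMap_surj {ι : Type} [Fintype ι] (p : ι → Fin 2 → k) (hp : Function.Injective p) (e : ι → ℕ) :
    ∃ d0, ∀ d ≥ d0, Function.Surjective ((locMap p e).domRestrict (homogeneousSubmodule (Fin 3) k d)) := by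
  let b := Module.finBasis k (∀ i, MvPolynomial (Fin 2) k ⧸ (mI (p i) ^ (e i)))
  have hco : Pairwise (fun i j => IsCoprime (mI (p i) ^ (e i)) (mI (p j) ^ (e j))) :=
    fun i j hij => mI_coprime (fun h => hij (hp h)) _ _
  have h1 : ∀ j, ∃ g : MvPolynomial (Fin 2) k, ∀ i, Ideal.Quotient.mk _ g = b j i :=
    fun j => Ideal.pi_quotient_surjective hco (b j)
  choose g hg using h1
  refine ⟨Finset.univ.sup fun j => (g j).totalDegree, fun d hd => ?_⟩
  rw [← LinearMap.range_eq_top, eq_top_iff, ← b.span_eq, Submodule.span_le]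
  rintro _ ⟨j, rfl⟩
  obtain ⟨G, hG, hG2⟩ := exists_homogenization (g j) d ((Finset.le_sup (f := fun j => (g j).totalDegree) (Finset.mem_univ j)).trans hd)
  refine ⟨⟨G, hG⟩, ?_⟩
  ext i
  change Ideal.Quotient.mk _ (dehom G) = _
  rw [hG2, hg]

theorem bezout {ι : Type} [Fintype ι] {n m : ℕ} {F G : MvPolynomial (Fin 3) k} (hF : F.IsHomogeneous n)
    (hG : G.IsHomogeneous m) (hFi : Irreducible F) (hFG : ¬ F ∣ G) (p : ι → Fin 2 → k) (hp : Function.Injective p)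
    (r s : ι → ℕ) (hr : ∀ i, dehom F ∈ mI (p i) ^ (r i)) (hs : ∀ i, dehom G ∈ mI (p i) ^ (s i)) :
    ∑ i, r i * s i ≤ n * m := by
  obtain ⟨c, hc⟩ := locMap_surj p hp (fun i => r i + s i)
  let d := c + n + m
  let f := (locMap p (fun i => r i + s i)).domRestrict (homogeneousSubmodule (Fin 3) k d)
  have hf : Function.Surjective f := hc d (by omega)
  let L : (homogeneousSubmodule (Fin 3) k (c + m) × homogeneousSubmodule (Fin 3) k (c + n)) →ₗ[k]
      homogeneousSubmodule (Fin 3) k d :=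
    (mulH F hF (c + m) d (by omega)).coprod (mulH G hG (c + n) d (by omega))
  let K : homogeneousSubmodule (Fin 3) k c →ₗ[k] (homogeneousSubmodule (Fin 3) k (c + m) × homogeneousSubmodule (Fin 3) k (c + n)) :=
    (-(mulH G hG c (c + m) (by omega))).prod (mulH F hF c (c + n) (by omega))
  have hK : LinearMap.ker L ≤ LinearMap.range K := by
    rintro ⟨⟨x, hx⟩, ⟨y, hy⟩⟩ h
    have h0 : F * x + G * y = 0 := congrArg Subtype.val h
    have h1 : F ∣ G * y := ⟨-x, by linear_combination h0⟩
    obtain ⟨w, rfl⟩ := (hFi.prime.dvd_or_dvd h1).resolve_left hFG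
    have hw : w.IsHomogeneous c := homog_cancel hF hFi.ne_zero (by rw [add_comm]; exact hy)
    refine ⟨⟨w, hw⟩, ?_⟩
    have hxw : x = -(G * w) := by
      apply mul_left_cancel₀ hFi.ne_zero; linear_combination h0
    refine Prod.ext (Subtype.ext ?_) (Subtype.ext ?_)
    · exact hxw.symm
    · rfl
  have e1 := finrank_map_ineq f hf (LinearMap.range L)
  have e2 : Module.finrank k ((LinearMap.range L).map f) ≤ ∑ i, (s i + 1).choose 2 + ∑ i, (r i + 1).choose 2 := by
    let S := ((locMap p s).domRestrict (homogeneousSubmodule (Fin 3) k (c + m))).prodMap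
      ((locMap p r).domRestrict (homogeneousSubmodule (Fin 3) k (c + n)))
    have := finrank_range_of_ker S (f ∘ₗ L) (by
      rintro ⟨⟨x, hx⟩, ⟨y, hy⟩⟩ h
      have ha : locMap p s x = 0 := congrArg Prod.fst h
      have hb : locMap p r y = 0 := congrArg Prod.snd h
      rw [locMap_eq_zero] at ha hb
      change locMap p (fun i => r i + s i) (F * x + G * y) = 0
      rw [locMap_eq_zero]
      intro i
      rw [map_add, map_mul, map_mul]
      refine add_mem ?_ ?_
      · rw [pow_add]; exact Ideal.mul_mem_mul (hr i) (ha i)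
      · rw [add_comm, pow_add]; exact Ideal.mul_mem_mul (hs i) (hb i))
    rw [Module.finrank_prod, finrank_loc, finrank_loc, LinearMap.range_comp] at this
    exact this
  have e3 := L.finrank_range_add_finrank_ker
  have e4 := (Submodule.finrank_mono hK).trans (LinearMap.finrank_range_le K)
  rw [Module.finrank_prod, finrank_homog, finrank_homog] at e3
  rw [finrank_homog] at e4
  rw [finrank_loc, finrank_homog] at e1
  have e5 : ∑ i, (r i + s i + 1).choose 2 = ∑ i, (r i + 1).choose 2 + ∑ i, (s i + 1).choose 2 + ∑ i, r i * s i := by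
    rw [← Finset.sum_add_distrib, ← Finset.sum_add_distrib]
    exact Finset.sum_congr rfl fun i _ => tri_add _ _
  have e6 := tri_add (c + m + 1) n
  have e7 := tri_add (c + 1) n
  have e8 : (c + m + 1) * n = (c + 1) * n + n * m := by ring
  rw [show c + m + 1 + n + 1 = d + 2 by omega, show c + m + 1 + 1 = c + m + 2 by omega] at e6
  rw [show c + 1 + n + 1 = c + n + 2 by omega, show c + 1 + 1 = c + 2 by omega] at e7
  omega


/-- `F (X + t p)` -/
noncomputable def ray (p : Fin 3 → k) : MvPolynomial (Fin 3) k →ₐ[k] Polynomial (MvPolynomial (Fin 3) k) :=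
  aeval (fun i => Polynomial.C (X i) + Polynomial.X * Polynomial.C (C (p i)))

lemma lin_natDegree {R : Type} [CommRing R] (a b : R) (e : ℕ) :
    ((Polynomial.C a + Polynomial.X * Polynomial.C b) ^ e).natDegree ≤ e := by
  refine Polynomial.natDegree_pow_le.trans ?_
  have : (Polynomial.C a + Polynomial.X * Polynomial.C b).natDegree ≤ 1 := by
    rw [add_comm, mul_comm]; exact Polynomial.natDegree_linear_le
  nlinarith

lemma reflect_lin {R : Type} [CommRing R] (a b : R) (e : ℕ) :
    Polynomial.reflect e ((Polynomial.C a + Polynomial.X * Polynomial.C b) ^ e) =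
      (Polynomial.C b + Polynomial.X * Polynomial.C a) ^ e := by
  induction e with
  | zero => simp
  | succ e ih =>
    have h1 : Polynomial.reflect 1 (Polynomial.C a + Polynomial.X * Polynomial.C b) =
        (Polynomial.C b + Polynomial.X * Polynomial.C a) := by
      rw [Polynomial.reflect_add, Polynomial.reflect_C, mul_comm Polynomial.X (Polynomial.C b), Polynomial.reflect_C_mul,
        Polynomial.reflect_one_X]
      ring
    rw [pow_succ, Polynomial.reflect_mul _ _ (lin_natDegree a b e) (by simpa using lin_natDegree a b 1), ih, h1, pow_succ]

lemma ray_eq_reflect (p : Fin 3 → k) {n : ℕ} {F : MvPolynomial (Fin 3) k} (hF : F.IsHomogeneous n) :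
    ray p F = Polynomial.reflect n (tay p F) := by
  have hsum : ∀ (s : Finset (Fin 3 →₀ ℕ)) (g : (Fin 3 →₀ ℕ) → Polynomial (MvPolynomial (Fin 3) k)),
    Polynomial.reflect n (∑ e ∈ s, g e) = ∑ e ∈ s, Polynomial.reflect n (g e) := by
    intro s g
    classical
    induction s using Finset.induction_on with
    | empty => simp
    | insert a s ha ih => rw [Finset.sum_insert ha, Finset.sum_insert ha, Polynomial.reflect_add, ih]
  rw [F.as_sum, map_sum, map_sum, hsum]
  refine Finset.sum_congr rfl fun e he => ?_
  have hn : n = e 0 + e 1 + e 2 := by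
    rw [hF.degree_eq_sum_deg_support he, ← Fin.sum_univ_three (fun i => e i)]
    exact Finsupp.sum_fintype e (fun _ a => a) (by simp)
  rw [monomial_eq, Finsupp.prod_fintype _ _ (by simp), Fin.prod_univ_three]
  simp only [map_mul, map_pow, tay_X, tay_C]
  have hC : ray p (C (F.coeff e)) = Polynomial.C (C (F.coeff e)) := by
    simp [ray, Polynomial.algebraMap_apply, algebraMap_eq]
  have hX : ∀ i, ray p (X i) = Polynomial.C (X i) + Polynomial.X * Polynomial.C (C (p i)) := by
    intro i; simp [ray]
  rw [hC, Polynomial.reflect_C_mul, hn, Polynomial.reflect_mul _ _ ?_ (lin_natDegree _ _ _),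
    Polynomial.reflect_mul _ _ (lin_natDegree _ _ _) (lin_natDegree _ _ _), reflect_lin, reflect_lin, reflect_lin,
    hX, hX, hX]
  refine Polynomial.natDegree_mul_le.trans (add_le_add (lin_natDegree _ _ _) (lin_natDegree _ _ _))

lemma ray_coeff (p : Fin 3 → k) {n : ℕ} {F : MvPolynomial (Fin 3) k} (hF : F.IsHomogeneous n) (j : ℕ) (hj : j ≤ n) :
    (ray p F).coeff (n - j) = (tay p F).coeff j := by
  rw [ray_eq_reflect p hF, Polynomial.coeff_reflect, Polynomial.revAt_le (by omega)]
  congr 1; omega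

lemma tay_natDegree (p : Fin 3 → k) {n : ℕ} {F : MvPolynomial (Fin 3) k} (hF : F.IsHomogeneous n) :
    (tay p F).natDegree ≤ n := by
  have : tay p F = Polynomial.reflect n (ray p F) := by rw [ray_eq_reflect p hF, Polynomial.reflect_reflect]
  unfold tay
  rw [aeval_def, eval₂_eq']
  refine Polynomial.natDegree_sum_le_of_forall_le _ _ fun e he => ?_
  rw [Polynomial.algebraMap_apply, Fin.prod_univ_three]
  refine (Polynomial.natDegree_C_mul_le _ _).trans ?_
  have hn : n = e 0 + e 1 + e 2 := by
    rw [hF.degree_eq_sum_deg_support he, ← Fin.sum_univ_three (fun i => e i)]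
    exact Finsupp.sum_fintype e (fun _ a => a) (by simp)
  rw [hn]
  refine Polynomial.natDegree_mul_le.trans (add_le_add (Polynomial.natDegree_mul_le.trans (add_le_add (lin_natDegree _ _ _) (lin_natDegree _ _ _))) (lin_natDegree _ _ _))

lemma order_le_degree (p : Fin 3 → k) {n r : ℕ} {F : MvPolynomial (Fin 3) k} (hF : F.IsHomogeneous n)
    (h : (tay p F).coeff r ≠ 0) : r ≤ n :=
  (Polynomial.le_natDegree_of_ne_zero h).trans (tay_natDegree p hF)

lemma ray_natDegree (p : Fin 3 → k) {n r : ℕ} {F : MvPolynomial (Fin 3) k} (hF : F.IsHomogeneous n)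
    (h : Polynomial.X ^ r ∣ tay p F) : (ray p F).natDegree ≤ n - r := by
  rw [Polynomial.natDegree_le_iff_coeff_eq_zero]
  intro j hj
  rw [ray_eq_reflect p hF, Polynomial.coeff_reflect]
  by_cases hjn : j ≤ n
  · rw [Polynomial.revAt_le hjn]
    exact Polynomial.X_pow_dvd_iff.1 h _ (by omega)
  · rw [Polynomial.revAt_eq_self_of_lt (by omega)]
    exact Polynomial.coeff_eq_zero_of_natDegree_lt (by have := tay_natDegree p hF; omega)

lemma ray_ray (p q : Fin 3 → k) : (Polynomial.eval₂RingHom (ray p : MvPolynomial (Fin 3) k →+* _) Polynomial.X).comp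
    (Polynomial.eval₂RingHom (ray q : MvPolynomial (Fin 3) k →+* _) Polynomial.X) =
    Polynomial.eval₂RingHom (ray (p + q) : MvPolynomial (Fin 3) k →+* Polynomial (MvPolynomial (Fin 3) k)) Polynomial.X := by
  apply Polynomial.ringHom_ext'
  · apply MvPolynomial.ringHom_ext
    · intro a; simp [ray, Polynomial.algebraMap_apply, algebraMap_eq]
    · intro i; simp [ray, Polynomial.algebraMap_apply, algebraMap_eq]; ring
  · simp

lemma ray_zero : Polynomial.eval₂RingHom (ray (0 : Fin 3 → k) : MvPolynomial (Fin 3) k →+* _) Polynomial.X = RingHom.id _ := by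
  apply Polynomial.ringHom_ext'
  · apply MvPolynomial.ringHom_ext
    · intro a; simp [ray, Polynomial.algebraMap_apply, algebraMap_eq]
    · intro i; simp [ray]
  · simp

lemma ray_irreducible (p : Fin 3 → k) {F : MvPolynomial (Fin 3) k} (hF : Irreducible F) : Irreducible (ray p F) := by
  let e : Polynomial (MvPolynomial (Fin 3) k) ≃+* Polynomial (MvPolynomial (Fin 3) k) :=
    RingEquiv.ofRingHom (Polynomial.eval₂RingHom (ray p : MvPolynomial (Fin 3) k →+* _) Polynomial.X)
      (Polynomial.eval₂RingHom (ray (-p) : MvPolynomial (Fin 3) k →+* _) Polynomial.X)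
      (by rw [ray_ray, add_neg_cancel, ray_zero]) (by rw [ray_ray, neg_add_cancel, ray_zero])
  have h1 : ray p F = e (Polynomial.C F) := by
    simp [e]
  rw [h1]
  have h2 : Prime (Polynomial.C F) := Polynomial.prime_C_iff.2 hF.prime
  exact ((MulEquiv.prime_iff e.toMulEquiv).2 h2).irreducible

/-- the specialization `F (u + t p)` -/
noncomputable def rayAt (p u : Fin 3 → k) (F : MvPolynomial (Fin 3) k) : Polynomial k := (ray p F).map (eval u)

lemma rayAt_eval (p u : Fin 3 → k) (F : MvPolynomial (Fin 3) k) (t : k) :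
    (rayAt p u F).eval t = eval (u + t • p) F := by
  have : ((Polynomial.evalRingHom t).comp ((Polynomial.mapRingHom (eval u)).comp (ray p : MvPolynomial (Fin 3) k →+* _))) =
    eval (u + t • p) := by
    apply MvPolynomial.ringHom_ext
    · intro a; simp [ray, Polynomial.algebraMap_apply, algebraMap_eq]
    · intro i; simp [ray]; ring
  exact congrArg (fun f => f F) this

lemma rayAt_natDegree (p u : Fin 3 → k) {n r : ℕ} {F : MvPolynomial (Fin 3) k} (hF : F.IsHomogeneous n) (hr : r ≤ n)
    (h : Polynomial.X ^ r ∣ tay p F) (hu : eval u ((tay p F).coeff r) ≠ 0) : (rayAt p u F).natDegree = n - r := by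
  apply le_antisymm
  · exact Polynomial.natDegree_map_le.trans (ray_natDegree p hF h)
  · apply Polynomial.le_natDegree_of_ne_zero
    rwa [rayAt, Polynomial.coeff_map, ray_coeff p hF r hr]

theorem sep_claim [CharZero k] (p : Fin 3 → k) {n r : ℕ} {F : MvPolynomial (Fin 3) k} (hF : F.IsHomogeneous n)
    (hFi : Irreducible F) (h : Polynomial.X ^ r ∣ tay p F) (h2 : (tay p F).coeff r ≠ 0) :
    ∃ D : MvPolynomial (Fin 3) k, D ≠ 0 ∧ ∀ u, eval u D ≠ 0 →
      (rayAt p u F).Separable ∧ (rayAt p u F).natDegree = n - r := by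
  have hrn := order_le_degree p hF h2
  have hir := ray_irreducible p hFi
  by_cases hd : n - r = 0
  · refine ⟨(tay p F).coeff r, h2, fun u hu => ?_⟩
    have h3 := rayAt_natDegree p u hF hrn h hu
    refine ⟨?_, h3⟩
    rw [hd] at h3
    have h4 : rayAt p u F ≠ 0 := by
      intro h0
      have : (rayAt p u F).coeff (n - r) ≠ 0 := by
        rwa [rayAt, Polynomial.coeff_map, ray_coeff p hF r hrn]
      rw [h0] at this; simp at this
    rw [Polynomial.eq_C_of_natDegree_eq_zero h3] at h4 ⊢
    rw [Polynomial.separable_C]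
    exact isUnit_iff_ne_zero.2 (fun h => h4 (by rw [h]; simp))
  · have hnd : (ray p F).natDegree ≠ 0 := by
      have : n - r ≤ (ray p F).natDegree := by
        apply Polynomial.le_natDegree_of_ne_zero
        rwa [ray_coeff p hF r hrn]
      omega
    have hprim := hir.isPrimitive hnd
    let K := FractionRing (MvPolynomial (Fin 3) k)
    have hK : Irreducible ((ray p F).map (algebraMap _ K)) :=
      (hprim.irreducible_iff_irreducible_map_fraction_map).1 hir
    haveI : CharZero K := charZero_of_injective_algebraMap (R := MvPolynomial (Fin 3) k) (IsFractionRing.injective _ _)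
    have hsep : ((ray p F).map (algebraMap _ K)).Separable := hK.separable
    obtain ⟨a, b, hab⟩ := hsep
    obtain ⟨c, hc, hc2⟩ := IsLocalization.integerNormalization_spec (nonZeroDivisors (MvPolynomial (Fin 3) k)) a
    obtain ⟨d, hd, hd2⟩ := IsLocalization.integerNormalization_spec (nonZeroDivisors (MvPolynomial (Fin 3) k)) b
    set a' := IsLocalization.integerNormalization (nonZeroDivisors (MvPolynomial (Fin 3) k)) a
    set b' := IsLocalization.integerNormalization (nonZeroDivisors (MvPolynomial (Fin 3) k)) b
    have key : Polynomial.C d * a' * ray p F + Polynomial.C c * b' * Polynomial.derivative (ray p F) = Polynomial.C (c * d) := by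
      apply Polynomial.map_injective (algebraMap (MvPolynomial (Fin 3) k) K) (IsFractionRing.injective _ _)
      rw [Polynomial.derivative_map] at hab
      simp only [Polynomial.map_add, Polynomial.map_mul, Polynomial.map_C, hc2, hd2, map_mul]
      rw [Algebra.smul_def, Algebra.smul_def, Polynomial.algebraMap_apply, Polynomial.algebraMap_apply]
      linear_combination Polynomial.C (algebraMap _ K c) * Polynomial.C (algebraMap _ K d) * hab
    refine ⟨c * d * (tay p F).coeff r, mul_ne_zero (mul_ne_zero (nonZeroDivisors.ne_zero hc) (nonZeroDivisors.ne_zero hd)) h2, fun u hu => ?_⟩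
    rw [map_mul] at hu
    obtain ⟨hu1, hu2⟩ := mul_ne_zero_iff.1 hu
    refine ⟨?_, rayAt_natDegree p u hF hrn h hu2⟩
    have k2 := congrArg (Polynomial.map (eval u)) key
    simp only [Polynomial.map_add, Polynomial.map_mul, Polynomial.map_C, ← Polynomial.derivative_map] at k2
    refine ⟨Polynomial.C (eval u (c * d))⁻¹ * (Polynomial.C (eval u d) * a'.map (eval u)),
      Polynomial.C (eval u (c * d))⁻¹ * (Polynomial.C (eval u c) * b'.map (eval u)), ?_⟩
    have k3 : Polynomial.C (eval u (c * d))⁻¹ * Polynomial.C (eval u (c * d)) = 1 := by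
      rw [← Polynomial.C_mul, inv_mul_cancel₀ hu1, Polynomial.C_1]
    rw [← k3, ← k2, rayAt]
    ring


/-- pairwise distinct points of the projective plane -/
def Cfg {ι : Type} (pts : ι → Fin 3 → k) : Prop :=
  (∀ i, pts i ≠ 0) ∧ ∀ i j, i ≠ j → ∀ c : k, pts i ≠ c • pts j

lemma chart [CharZero k] {ι : Type} [Fintype ι] (pts : ι → Fin 3 → k) (h : Cfg pts) :
    ∃ (A : Matrix.GeneralLinearGroup (Fin 3) k) (p : ι → Fin 2 → k), Function.Injective p ∧
      ∀ (F : MvPolynomial (Fin 3) k) (n : ℕ), F.IsHomogeneous n → ∀ i r, Polynomial.X ^ r ∣ tay (pts i) F →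
        dehom (bind₁ (linMap A) F) ∈ mI (p i) ^ r := by
  have h1 : ∃ l : Fin 3 → k, l 0 ≠ 0 ∧ ∀ i, ∑ j, pts i j * l j ≠ 0 := by
    have hne : (X 0 * ∏ i, ∑ j, C (pts i j) * X j : MvPolynomial (Fin 3) k) ≠ 0 := by
      refine mul_ne_zero (X_ne_zero _) (Finset.prod_ne_zero_iff.2 fun i _ => ?_)
      intro h0
      apply h.1 i
      ext j
      have := congrArg (eval (Pi.single j (1 : k))) h0
      simpa [Pi.single_apply] using this
    obtain ⟨l, hl⟩ : ∃ l, eval l (X 0 * ∏ i, ∑ j, C (pts i j) * X j : MvPolynomial (Fin 3) k) ≠ 0 := by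
      by_contra! hc
      exact hne (MvPolynomial.funext fun x => by rw [hc x]; simp)
    simp only [map_mul, eval_X, map_prod, map_sum, eval_C] at hl
    obtain ⟨ha, hb⟩ := mul_ne_zero_iff.1 hl
    exact ⟨l, ha, fun i => Finset.prod_ne_zero_iff.1 hb i (Finset.mem_univ i)⟩
  obtain ⟨l, hl0, hl⟩ := h1
  let M0 : Matrix (Fin 3) (Fin 3) k := !![0, 1, 0; 0, 0, 1; l 0, l 1, l 2]
  have hdet : M0.det ≠ 0 := by
    simp [M0, Matrix.det_fin_three, hl0]
  let M := Matrix.GeneralLinearGroup.mkOfDetNeZero M0 hdet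
  let q : ι → Fin 3 → k := fun i => M0.mulVec (pts i)
  have hq2 : ∀ i, q i 2 ≠ 0 := by
    intro i
    have := hl i
    simp [q, M0, Matrix.mulVec, dotProduct, Fin.sum_univ_three] at this ⊢
    intro h0; apply this; linear_combination h0
  have hA : ∀ v, ((M⁻¹ : Matrix.GeneralLinearGroup (Fin 3) k) : Matrix (Fin 3) (Fin 3) k).mulVec (M0.mulVec v) = v := by
    intro v
    rw [Matrix.mulVec_mulVec]
    have : ((M⁻¹ : Matrix.GeneralLinearGroup (Fin 3) k) : Matrix (Fin 3) (Fin 3) k) * M0 = 1 := by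
      have := congrArg Units.val (inv_mul_cancel M)
      exact this
    rw [this, Matrix.one_mulVec]
  have hp3 : ∀ i, (![q i 0 / q i 2, q i 1 / q i 2, 1] : Fin 3 → k) = (q i 2)⁻¹ • q i := by
    intro i; ext j
    have := hq2 i
    fin_cases j <;> simp [this, div_eq_inv_mul]
  refine ⟨M⁻¹, fun i => ![q i 0 / q i 2, q i 1 / q i 2], ?_, ?_⟩
  · intro i j hij
    by_contra hne
    have h0 : q i 0 / q i 2 = q j 0 / q j 2 := congrFun hij 0
    have h1 : q i 1 / q i 2 = q j 1 / q j 2 := congrFun hij 1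
    have h3 : (q i 2)⁻¹ • q i = (q j 2)⁻¹ • q j := by rw [← hp3, ← hp3, h0, h1]
    apply h.2 i j hne (q i 2 * (q j 2)⁻¹)
    have h4 : q i = (q i 2 * (q j 2)⁻¹) • q j := by
      rw [mul_smul, ← h3, smul_smul, mul_inv_cancel₀ (hq2 i), one_smul]
    have h5 := congrArg (fun v => ((M⁻¹ : Matrix.GeneralLinearGroup (Fin 3) k) : Matrix (Fin 3) (Fin 3) k).mulVec v) h4
    simp only [Matrix.mulVec_smul] at h5
    simp only [q, hA] at h5
    exact h5
  · intro F n hF i r hr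
    apply dehom_mem
    obtain ⟨B, a, ha, hB⟩ := (locEq_lin M⁻¹ F (q i)).trans (locEq_scale (homog_lin M⁻¹ hF) (q i) (q i 2)⁻¹ (inv_ne_zero (hq2 i)))
    have := (hB r (by simp only [q, hA]; exact hr)).1
    rw [← hp3] at this
    exact this

lemma exists_eval_ne [CharZero k] {F : MvPolynomial (Fin 3) k} (hF : F ≠ 0) : ∃ p, eval p F ≠ 0 := by
  by_contra! hc
  exact hF (MvPolynomial.funext fun x => by rw [hc x]; simp)

lemma extra_zero [CharZero k] [IsAlgClosed k] {n : ℕ} {F : MvPolynomial (Fin 3) k} (hF : F.IsHomogeneous n) (hn : 1 ≤ n)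
    (hF0 : F ≠ 0) {ι : Type} [Fintype ι] (pts : ι → Fin 3 → k) :
    ∃ v, v ≠ 0 ∧ eval v F = 0 ∧ ∀ i (c : k), v ≠ c • pts i := by
  obtain ⟨p, hp⟩ := exists_eval_ne hF0
  let pt : Option ι → Fin 3 → k := fun o => o.elim 0 pts
  have h1 : ∃ u, ∀ o, u ∉ Submodule.span k {p, pt o} := by
    by_contra! hc
    obtain ⟨o, ho⟩ := Subspace.exists_eq_top_of_iUnion_eq_univ (p := fun o => Submodule.span k {p, pt o})
      (Set.eq_univ_of_forall fun u => by simpa using hc u)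
    classical
    have h2 := finrank_span_finset_le_card (R := k) ({p, pt o} : Finset (Fin 3 → k))
    rw [Finset.coe_pair, Set.finrank, ho, finrank_top, Module.finrank_fintype_fun_eq_card] at h2
    have h3 := Finset.card_le_two (a := p) (b := pt o)
    simp at h2; omega
  obtain ⟨u, hu⟩ := h1
  have hd := rayAt_natDegree (r := 0) p u hF (by omega) (by simp) (by rw [tay_coeff_zero]; simpa using hp)
  obtain ⟨t, ht⟩ := IsAlgClosed.exists_root (rayAt p u F) (by
    intro h; have := Polynomial.natDegree_eq_zero_iff_degree_le_zero.2 h.le; omega)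
  rw [Polynomial.IsRoot, rayAt_eval] at ht
  have key : ∀ o (c : k), u + t • p ≠ c • pt o := by
    intro o c h
    apply hu o
    rw [Submodule.mem_span_pair]
    exact ⟨-t, c, by rw [← h]; module⟩
  refine ⟨u + t • p, ?_, ht, fun i c => key (some i) c⟩
  simpa [pt] using key none 0

lemma extra_zeros [CharZero k] [IsAlgClosed k] {n : ℕ} {F : MvPolynomial (Fin 3) k} (hF : F.IsHomogeneous n) (hn : 1 ≤ n)
    (hF0 : F ≠ 0) {ι : Type} [Fintype ι] (pts : ι → Fin 3 → k) (hp : Cfg pts) (N : ℕ) :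
    ∃ (κ : Type) (_ : Fintype κ) (q : κ → Fin 3 → k), Fintype.card κ = N ∧ Cfg (Sum.elim pts q) ∧
      ∀ j, eval (q j) F = 0 := by
  induction N with
  | zero =>
    refine ⟨Empty, inferInstance, Empty.elim, by simp, ⟨?_, ?_⟩, by simp⟩
    · rintro (i | i)
      · exact hp.1 i
      · exact i.elim
    · rintro (i | i) (j | j) hij c
      · exact hp.2 i j (fun h => hij (by rw [h])) c
      · exact j.elim
      · exact i.elim
      · exact i.elim
  | succ N ih =>
    obtain ⟨κ, _, q, hc, hq, hq2⟩ := ih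
    obtain ⟨v, hv0, hv, hv2⟩ := extra_zero hF hn hF0 (Sum.elim pts q)
    have hv3 : ∀ i (c : k), Sum.elim pts q i ≠ c • v := by
      intro i c h
      by_cases hc0 : c = 0
      · exact hq.1 i (by rw [h, hc0, zero_smul])
      · apply hv2 i c⁻¹
        rw [h, smul_smul, inv_mul_cancel₀ hc0, one_smul]
    refine ⟨Option κ, inferInstance, fun o => o.elim v q, by simp [hc], ⟨?_, ?_⟩, ?_⟩
    · rintro (i | _ | i)
      · exact hp.1 i
      · exact hv0
      · exact hq.1 (Sum.inr i)
    · rintro (i | _ | i) (j | _ | j) hij c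
      · exact hq.2 (Sum.inl i) (Sum.inl j) (by simpa using hij) c
      · exact hv3 (Sum.inl i) c
      · exact hq.2 (Sum.inl i) (Sum.inr j) (by simp) c
      · exact hv2 (Sum.inl j) c
      · exact absurd rfl hij
      · exact hv2 (Sum.inr j) c
      · exact hq.2 (Sum.inr i) (Sum.inl j) (by simp) c
      · exact hv3 (Sum.inr i) c
      · exact hq.2 (Sum.inr i) (Sum.inr j) (by simpa using hij) c
    · rintro (_ | i)
      · exact hv
      · exact hq2 i

lemma degree_pos {n : ℕ} {F : MvPolynomial (Fin 3) k} (hF : F.IsHomogeneous n) (hFi : Irreducible F) : 1 ≤ n := by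
  by_contra! hn
  obtain rfl : n = 0 := by omega
  apply hFi.not_isUnit
  have := ((totalDegree_zero_iff_isHomogeneous _).2 hF)
  rw [totalDegree_eq_zero_iff_eq_C] at this
  rw [this]
  have h0 : F.coeff 0 ≠ 0 := fun h => hFi.ne_zero (by rw [this, h, C_0])
  exact (isUnit_iff_ne_zero.2 h0).map C

lemma not_dvd_of_degree {n m : ℕ} {F G : MvPolynomial (Fin 3) k} (hF : F.IsHomogeneous n) (hF0 : F ≠ 0)
    (hG : G.IsHomogeneous m) (hG0 : G ≠ 0) (h : m < n) : ¬ F ∣ G := by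
  rintro ⟨w, rfl⟩
  have hw : w ≠ 0 := right_ne_zero_of_mul hG0
  have := totalDegree_mul_of_isDomain hF0 hw
  rw [hG.totalDegree hG0, hF.totalDegree hF0] at this
  omega

theorem genus_bound [CharZero k] [IsAlgClosed k] {n : ℕ} {F : MvPolynomial (Fin 3) k} (hF : F.IsHomogeneous n)
    (hFi : Irreducible F) {ι : Type} [Fintype ι] (pts : ι → Fin 3 → k) (hp : Cfg pts) (m : ι → ℕ)
    (hm : ∀ i, Polynomial.X ^ (m i) ∣ tay (pts i) F) :
    ∑ i, m i * (m i - 1) ≤ (n - 1) * (n - 2) := by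
  have hn := degree_pos hF hFi
  have hF0 := hFi.ne_zero
  -- first estimate
  have first : ∑ i, m i * (m i - 1) ≤ n * (n - 1) := by
    obtain ⟨A, p, hpi, hA⟩ := chart pts hp
    have hD : ∃ i, pderiv i F ≠ 0 := by
      by_contra! hc
      have h1 := tay_derivative 0 F
      rw [(homog_iff_tay F n).1 hF] at h1
      simp only [hc, map_zero, mul_zero, Finset.sum_const_zero] at h1
      rw [Polynomial.derivative_C_mul_X_pow] at h1
      have h2 := congrArg (fun g => Polynomial.coeff g (n - 1)) h1
      simp only [Polynomial.coeff_C_mul, Polynomial.coeff_X_pow, if_true, mul_one, Polynomial.coeff_zero] at h2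
      rcases mul_eq_zero.1 h2 with h | h
      · exact hF0 h
      · have : (n : MvPolynomial (Fin 3) k) ≠ 0 := Nat.cast_ne_zero.2 (by omega)
        exact this h
    obtain ⟨i0, hi0⟩ := hD
    have hDh : (pderiv i0 F).IsHomogeneous (n - 1) := hF.pderiv
    refine bezout (homog_lin A hF) (homog_lin A hDh) (irreducible_lin A hFi) ?_ p hpi m (fun i => m i - 1)
      (fun i => hA F n hF i _ (hm i)) (fun i => hA _ _ hDh i _ ?_)
    · refine not_dvd_of_degree (homog_lin A hF) (irreducible_lin A hFi).ne_zero (homog_lin A hDh) ?_ (by omega)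
      rw [← linEquiv_apply]
      simpa using hi0
    · rw [Polynomial.X_pow_dvd_iff]
      intro j hj
      rw [tay_coeff_pderiv, Polynomial.X_pow_dvd_iff.1 (hm i) (j + 1) (by omega), map_zero]
  have hS : ∑ i, m i * (m i - 1) = 2 * ∑ i, (m i).choose 2 := by
    rw [Finset.mul_sum]
    refine Finset.sum_congr rfl fun i _ => ?_
    rcases h : m i with _ | a
    · simp
    · rw [tri_two]; simp; ring
  have hn2 := tri_two n
  set t := ∑ i, (m i).choose 2
  set T := (n + 1).choose 2
  have e1 : n * (n + 1) = n * (n - 1) + 2 * n := by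
    obtain ⟨a, rfl⟩ : ∃ a, n = a + 1 := ⟨n - 1, by omega⟩
    simp; ring
  have htT : t + 1 ≤ T := by omega
  obtain ⟨κ, _, q, hc, hq, hq2⟩ := extra_zeros hF hn hF0 pts hp (T - 1 - t)
  obtain ⟨A, p, hpi, hA⟩ := chart _ hq
  let s : ι ⊕ κ → ℕ := Sum.elim (fun i => m i - 1) (fun _ => 1)
  let r : ι ⊕ κ → ℕ := Sum.elim m (fun _ => 1)
  have hdim : Module.finrank k (∀ i, MvPolynomial (Fin 2) k ⧸ (mI (p i) ^ (s i))) = T - 1 := by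
    rw [finrank_loc, Fintype.sum_sum_type]
    have h1 : ∑ i, (s (Sum.inl i) + 1).choose 2 = t := by
      refine Finset.sum_congr rfl fun i _ => ?_
      simp only [s, Sum.elim_inl]
      rcases h : m i with _ | a
      · simp
      · simp
    have h2 : ∑ i, (s (Sum.inr i) + 1).choose 2 = T - 1 - t := by
      simp [s, hc]
    rw [h1, h2]; omega
  have hker := LinearMap.ker_ne_bot_of_finrank_lt (f := (locMap p s).domRestrict (homogeneousSubmodule (Fin 3) k (n - 1)))
    (by rw [hdim, finrank_homog, show n - 1 + 2 = n + 1 by omega]; omega)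
  obtain ⟨⟨G, hG⟩, hGk, hG0⟩ := Submodule.exists_mem_ne_zero_of_ne_bot hker
  have hG0' : G ≠ 0 := fun h => hG0 (Subtype.ext h)
  have hGk' : locMap p s G = 0 := hGk
  rw [locMap_eq_zero] at hGk'
  have hb := bezout (homog_lin A hF) hG (irreducible_lin A hFi)
    (not_dvd_of_degree (homog_lin A hF) (irreducible_lin A hFi).ne_zero hG hG0' (by omega)) p hpi r s (by
      rintro (i | i)
      · exact hA F n hF (Sum.inl i) _ (hm i)
      · refine hA F n hF (Sum.inr i) _ ?_
        simp only [r, Sum.elim_inr, pow_one]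
        rw [Polynomial.X_dvd_iff, tay_coeff_zero, hq2, C_0]) hGk'
  rw [Fintype.sum_sum_type] at hb
  simp only [r, s, Sum.elim_inl, Sum.elim_inr, mul_one, Finset.sum_const, Finset.card_univ, hc, smul_eq_mul] at hb
  have e2 : 2 * (n * (n - 1)) + 2 = n * (n + 1) + (n - 1) * (n - 2) := by
    obtain ⟨a, rfl⟩ : ∃ a, n = a + 1 := ⟨n - 1, by omega⟩
    rcases a with _ | b
    · simp
    · simp; ring
  omega


lemma aeval_ray {R : Type} [CommRing R] [Algebra k R] (p : Fin 3 → k) (q : Fin 3 → R) (c : R) (F : MvPolynomial (Fin 3) k) :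
    aeval (fun i => q i + c * algebraMap k R (p i)) F =
      Polynomial.eval₂ (aeval q : MvPolynomial (Fin 3) k →ₐ[k] R).toRingHom c (ray p F) := by
  have : (aeval (fun i => q i + c * algebraMap k R (p i)) : MvPolynomial (Fin 3) k →ₐ[k] R).toRingHom =
    (Polynomial.eval₂RingHom (aeval q : MvPolynomial (Fin 3) k →ₐ[k] R).toRingHom c).comp (ray p).toRingHom := by
    apply MvPolynomial.ringHom_ext
    · intro a; simp [ray, Polynomial.algebraMap_apply, algebraMap_eq]
    · intro i; simp [ray]; ring
  exact congrArg (fun f => f F) this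

lemma exists_transform {n r : ℕ} {F : MvPolynomial (Fin 3) k} (hF : F.IsHomogeneous n)
    (h : Polynomial.X ^ r ∣ tay (Pi.single 2 1) F) : ∃ G, bind₁ (stdQuad k) F = X 2 ^ r * G := by
  have h1 : bind₁ (stdQuad k) F = aeval (fun i => X 2 * (![X 1, X 0, 0] : Fin 3 → MvPolynomial (Fin 3) k) i +
      (X 0 * X 1) * algebraMap k _ ((Pi.single 2 1 : Fin 3 → k) i)) F := by
    refine congrArg (fun q => aeval q F) ?_
    ext1 i
    fin_cases i <;> simp [stdQuad] <;> ring
  change X 2 ^ r ∣ bind₁ (stdQuad k) F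
  rw [h1, aeval_ray, Polynomial.eval₂_eq_sum_range]
  refine Finset.dvd_sum fun i hi => Dvd.dvd.mul_right ?_ _
  have hi2 := ray_natDegree _ hF h
  simp at hi
  by_cases hin : i ≤ n
  · have h3 : (ray (Pi.single 2 1) F).coeff i = (tay (Pi.single 2 1) F).coeff (n - i) := by
      rw [← ray_coeff _ hF (n - i) (by omega)]; congr 1; omega
    rw [h3]
    change _ ∣ aeval _ _
    rw [homog_bind_scale (tay_coeff_homog _ _ _)]
    by_cases hr : n - i < r
    · rw [Polynomial.X_pow_dvd_iff.1 h _ hr]; simp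
    · exact Dvd.dvd.mul_right (pow_dvd_pow _ (by omega)) _
  · rw [Polynomial.coeff_eq_zero_of_natDegree_lt (by omega)]; simp

lemma stdQuad_homog (i : Fin 3) : (stdQuad k i).IsHomogeneous 2 := by
  fin_cases i
  · exact (isHomogeneous_X k 1).mul (isHomogeneous_X k 2)
  · exact (isHomogeneous_X k 0).mul (isHomogeneous_X k 2)
  · exact (isHomogeneous_X k 0).mul (isHomogeneous_X k 1)

lemma homog_quad {n : ℕ} {F : MvPolynomial (Fin 3) k} (hF : F.IsHomogeneous n) :
    (bind₁ (stdQuad k) F).IsHomogeneous (2 * n) := by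
  exact hF.aeval _ stdQuad_homog

lemma quad_quad {n : ℕ} {F : MvPolynomial (Fin 3) k} (hF : F.IsHomogeneous n) :
    bind₁ (stdQuad k) (bind₁ (stdQuad k) F) = (X 0 * X 1 * X 2) ^ n * F := by
  rw [bind₁_bind₁]
  have : (fun i => bind₁ (stdQuad k) (stdQuad k i)) = fun i => (X 0 * X 1 * X 2) * X i := by
    ext1 i
    fin_cases i <;> simp [stdQuad] <;> ring
  rw [this]
  change aeval _ F = _
  rw [homog_bind_scale hF]
  simp

lemma homog_of_mul {N : ℕ} {a b : MvPolynomial (Fin 3) k} (h : (a * b).IsHomogeneous N) (h0 : a * b ≠ 0) :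
    ∃ d, a.IsHomogeneous d := by
  have ha0 := left_ne_zero_of_mul h0
  have hb0 := right_ne_zero_of_mul h0
  have ha := tay_ne_zero 0 ha0
  have hb := tay_ne_zero 0 hb0
  rw [homog_iff_tay, map_mul] at h
  have h1 := congrArg Polynomial.natDegree h
  have h2 := congrArg Polynomial.natTrailingDegree h
  rw [Polynomial.natDegree_mul ha hb, Polynomial.natDegree_C_mul_X_pow _ _ h0] at h1
  rw [Polynomial.natTrailingDegree_mul ha hb, Polynomial.C_mul_X_pow_eq_monomial, Polynomial.natTrailingDegree_monomial h0] at h2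
  have h3 := Polynomial.natTrailingDegree_le_natDegree (tay 0 a)
  have h4 := Polynomial.natTrailingDegree_le_natDegree (tay 0 b)
  have h5 : (tay 0 a).natTrailingDegree = (tay 0 a).natDegree := by omega
  refine ⟨(tay 0 a).natDegree, ?_⟩
  have h6 : a = (tay 0 a).coeff (tay 0 a).natDegree := by
    conv_lhs => rw [← bind_eval_tay 0 a]
    have : (fun i => X i - C ((0 : Fin 3 → k) i)) = (X : Fin 3 → MvPolynomial (Fin 3) k) := by ext1 i; simp
    rw [this, bind₁_X_left, AlgHom.id_apply, Polynomial.eval_eq_sum_range, Finset.sum_eq_single (tay 0 a).natDegree]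
    · simp
    · intro j hj hne
      simp at hj
      rw [Polynomial.coeff_eq_zero_of_lt_natTrailingDegree (by omega), zero_mul]
    · simp
  rw [h6]
  have := tay_coeff_homog 0 a (tay 0 a).natDegree
  convert this using 2
  rw [← h6]

lemma tay_single_quad2 (i : Fin 3) : tay (Pi.single 2 (1 : k)) (stdQuad k i) =
    Polynomial.X * (![Polynomial.C (X 1) * (1 + Polynomial.X * Polynomial.C (X 2)),
      Polynomial.C (X 0) * (1 + Polynomial.X * Polynomial.C (X 2)),
      Polynomial.X * (Polynomial.C (X 0) * Polynomial.C (X 1))] : Fin 3 → Polynomial (MvPolynomial (Fin 3) k)) i := by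
  fin_cases i <;> simp [stdQuad, tay_X] <;> ring

lemma tay_single_quad0 (i : Fin 3) : tay (Pi.single 0 (1 : k)) (stdQuad k i) =
    Polynomial.X * (![Polynomial.X * (Polynomial.C (X 1) * Polynomial.C (X 2)),
      Polynomial.C (X 2) * (1 + Polynomial.X * Polynomial.C (X 0)),
      Polynomial.C (X 1) * (1 + Polynomial.X * Polynomial.C (X 0))] : Fin 3 → Polynomial (MvPolynomial (Fin 3) k)) i := by
  fin_cases i <;> simp [stdQuad, tay_X] <;> ring

lemma tay_single_quad1 (i : Fin 3) : tay (Pi.single 1 (1 : k)) (stdQuad k i) =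
    Polynomial.X * (![Polynomial.C (X 2) * (1 + Polynomial.X * Polynomial.C (X 1)),
      Polynomial.X * (Polynomial.C (X 0) * Polynomial.C (X 2)),
      Polynomial.C (X 0) * (1 + Polynomial.X * Polynomial.C (X 1))] : Fin 3 → Polynomial (MvPolynomial (Fin 3) k)) i := by
  fin_cases i <;> simp [stdQuad, tay_X] <;> ring

lemma tay_vertex (j : Fin 3) (q : Fin 3 → Polynomial (MvPolynomial (Fin 3) k))
    (hq : ∀ i, tay (Pi.single j (1 : k)) (stdQuad k i) = Polynomial.X * q i) {n : ℕ} {F : MvPolynomial (Fin 3) k}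
    (hF : F.IsHomogeneous n) :
    tay (Pi.single j 1) (bind₁ (stdQuad k) F) = Polynomial.X ^ n * aeval q F := by
  rw [tay_bind₁, ← homog_bind_scale hF]
  exact congrArg (fun q => aeval q F) (funext hq)

lemma coeff_zero_aeval (q : Fin 3 → Polynomial (MvPolynomial (Fin 3) k)) (F : MvPolynomial (Fin 3) k) :
    (aeval q F).coeff 0 = bind₁ (fun i => (q i).coeff 0) F := by
  have : (Polynomial.constantCoeff : Polynomial (MvPolynomial (Fin 3) k) →+* _).comp (aeval q : MvPolynomial (Fin 3) k →ₐ[k] _).toRingHom =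
    (bind₁ (fun i => (q i).coeff 0) : MvPolynomial (Fin 3) k →ₐ[k] _).toRingHom := by
    apply MvPolynomial.ringHom_ext
    · intro a; simp [Polynomial.algebraMap_apply, algebraMap_eq, -algHom_C]; rw [bind₁_C_right]
    · intro i; simp
  exact congrArg (fun f => f F) this


/-- Excellent position data. -/
structure Exc (F G : MvPolynomial (Fin 3) k) (n r : ℕ) : Prop where
  hF : F.IsHomogeneous n
  hFi : Irreducible F
  hr : 2 ≤ r
  hd : Polynomial.X ^ r ∣ tay (Pi.single 2 1) F
  hc : (tay (Pi.single 2 1) F).coeff r ≠ 0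
  h0 : eval (Pi.single 0 1) F ≠ 0
  h1 : eval (Pi.single 1 1) F ≠ 0
  f1 : (rayAt (Pi.single 2 1) (Pi.single 0 1) F).Separable
  f1d : (rayAt (Pi.single 2 1) (Pi.single 0 1) F).natDegree = n - r
  f2 : (rayAt (Pi.single 2 1) (Pi.single 1 1) F).Separable
  f2d : (rayAt (Pi.single 2 1) (Pi.single 1 1) F).natDegree = n - r
  f3 : (rayAt (Pi.single 0 1) (Pi.single 1 1) F).Separable
  f3d : (rayAt (Pi.single 0 1) (Pi.single 1 1) F).natDegree = n
  hG : bind₁ (stdQuad k) F = X 2 ^ r * G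

namespace Exc
variable {F G : MvPolynomial (Fin 3) k} {n r : ℕ}

lemma rn (h : Exc F G n r) : r ≤ n := order_le_degree _ h.hF h.hc

lemma quad_ne {F : MvPolynomial (Fin 3) k} {n : ℕ} (hF : F.IsHomogeneous n) (hF0 : F ≠ 0) : bind₁ (stdQuad k) F ≠ 0 := by
  intro h
  have := quad_quad hF
  rw [h, map_zero] at this
  have h2 : (X 0 * X 1 * X 2 : MvPolynomial (Fin 3) k) ^ n * F ≠ 0 :=
    mul_ne_zero (pow_ne_zero _ (mul_ne_zero (mul_ne_zero (X_ne_zero _) (X_ne_zero _)) (X_ne_zero _))) hF0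
  exact h2 this.symm

lemma G0 (h : Exc F G n r) : G ≠ 0 := by
  intro h0
  apply quad_ne h.hF h.hFi.ne_zero
  rw [h.hG, h0, mul_zero]

lemma homG (h : Exc F G n r) : G.IsHomogeneous (2 * n - r) := by
  have := homog_quad h.hF
  rw [h.hG] at this
  have hrn := h.rn
  refine homog_cancel (F := X 2 ^ r) (n := r) (by simpa using (isHomogeneous_X k (2 : Fin 3)).pow r) (pow_ne_zero _ (X_ne_zero _)) ?_
  convert this using 1
  omega

lemma quadG (h : Exc F G n r) : bind₁ (stdQuad k) G = X 0 ^ (n - r) * X 1 ^ (n - r) * X 2 ^ n * F := by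
  have h1 := quad_quad h.hF
  rw [h.hG] at h1
  have hrn := h.rn
  obtain ⟨s, rfl⟩ := Nat.exists_eq_add_of_le hrn
  have h2 : (X 0 * X 1 : MvPolynomial (Fin 3) k) ^ r ≠ 0 := pow_ne_zero _ (mul_ne_zero (X_ne_zero _) (X_ne_zero _))
  apply mul_left_cancel₀ h2
  rw [map_mul, map_pow, bind₁_X_right] at h1
  have h3 : stdQuad k 2 = X 0 * X 1 := by simp [stdQuad]
  rw [h3] at h1
  rw [h1, Nat.add_sub_cancel_left]
  ring

lemma evalG (h : Exc F G n r) (v : Fin 3 → k) : v 2 ^ r * eval v G = eval (fun i => eval v (stdQuad k i)) F := by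
  have := congrArg (eval v) h.hG
  rw [map_mul, map_pow, eval_X] at this
  rw [← this]
  exact eval₂Hom_bind₁ _ _ _ _

lemma eval_homog {F : MvPolynomial (Fin 3) k} {n : ℕ} (hF : F.IsHomogeneous n) (c : k) (v : Fin 3 → k) :
    eval (c • v) F = c ^ n * eval v F := by
  have := homog_bind_scale hF c v
  have e : c • v = fun i => c * v i := by ext i; simp
  rw [e]
  simpa [aeval_eq_eval] using this

lemma side0 (h : Exc F G n r) (v : Fin 3 → k) (h0 : v 0 = 0) (h1 : v 1 ≠ 0) (h2 : v 2 ≠ 0) : eval v G ≠ 0 := by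
  intro hz
  have := h.evalG v
  rw [hz, mul_zero] at this
  have e : (fun i => eval v (stdQuad k i)) = (v 1 * v 2) • (Pi.single 0 1 : Fin 3 → k) := by
    ext i; fin_cases i <;> simp [stdQuad, h0]
  rw [e, eval_homog h.hF] at this
  exact mul_ne_zero (pow_ne_zero _ (mul_ne_zero h1 h2)) h.h0 this.symm

lemma side1 (h : Exc F G n r) (v : Fin 3 → k) (h0 : v 1 = 0) (h1 : v 0 ≠ 0) (h2 : v 2 ≠ 0) : eval v G ≠ 0 := by
  intro hz
  have := h.evalG v
  rw [hz, mul_zero] at this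
  have e : (fun i => eval v (stdQuad k i)) = (v 0 * v 2) • (Pi.single 1 1 : Fin 3 → k) := by
    ext i; fin_cases i <;> simp [stdQuad, h0]
  rw [e, eval_homog h.hF] at this
  exact mul_ne_zero (pow_ne_zero _ (mul_ne_zero h1 h2)) h.h1 this.symm

lemma not_X0 (h : Exc F G n r) : ¬ X 0 ∣ G := by
  rintro ⟨w, hw⟩
  apply h.side0 ![0,1,1] (by simp) (by simp) (by simp)
  rw [hw]; simp

lemma not_X1 (h : Exc F G n r) : ¬ X 1 ∣ G := by
  rintro ⟨w, hw⟩
  apply h.side1 ![1,0,1] (by simp) (by simp) (by simp)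
  rw [hw]; simp

lemma not_X2 (h : Exc F G n r) : ¬ X 2 ∣ G := by
  rintro ⟨w, hw⟩
  have hrn := h.rn
  have hr := h.hr
  have hG := h.homG
  have hw' : w.IsHomogeneous (2 * n - r - 1) := by
    refine homog_cancel (isHomogeneous_X k (2 : Fin 3)) (X_ne_zero _) ?_
    rw [← hw]; convert hG using 1; omega
  have e1 : stdQuad k 2 = X 0 * X 1 := by simp [stdQuad]
  have e : (X 0 * X 1 * X 2 : MvPolynomial (Fin 3) k) ^ n * F = (X 0 * X 1) ^ (r + 1) * bind₁ (stdQuad k) w := by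
    rw [← quad_quad h.hF, h.hG, hw, map_mul, map_pow, map_mul, bind₁_X_right, e1]; ring
  have e2 := congrArg (tay (Pi.single 2 1)) e
  obtain ⟨q, hq⟩ : ∃ q, tay (Pi.single 2 1) (bind₁ (stdQuad k) w) = Polynomial.X ^ (2 * n - r - 1) * q := ⟨_, tay_vertex 2 _ tay_single_quad2 hw'⟩
  rw [map_mul, map_mul, hq] at e2
  obtain ⟨f, hf⟩ := h.hd
  have hf0 : f.coeff 0 ≠ 0 := by
    have := h.hc
    rw [hf] at this
    simpa [Polynomial.coeff_X_pow_mul'] using this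
  simp only [map_pow, map_mul, tay_X, hf] at e2
  simp only [Pi.single_apply] at e2
  simp at e2
  set a : Polynomial (MvPolynomial (Fin 3) k) := Polynomial.C (X 0) with ha
  set b : Polynomial (MvPolynomial (Fin 3) k) := Polynomial.C (X 1) with hb
  set c : Polynomial (MvPolynomial (Fin 3) k) := Polynomial.C (X 2) with hc
  obtain ⟨M, hM⟩ : ∃ M, 2 * n - r - 1 + 2 * (r + 1) = 2 * n + r + M ∧ 1 ≤ M := ⟨1, by omega⟩
  have e3 : Polynomial.X ^ (2 * n + r) * ((a * b * (1 + Polynomial.X * c)) ^ n * f) =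
     Polynomial.X ^ (2 * n + r) * (Polynomial.X ^ M * ((a * b) ^ (r + 1) * q)) := by
    rw [← mul_assoc (Polynomial.X ^ (2 * n + r)) (Polynomial.X ^ M), ← pow_add, ← hM.1]
    calc _ = _ := ?_
      _ = _ := e2
      _ = _ := ?_
    · rw [show a * Polynomial.X * (b * Polynomial.X) * (1 + c * Polynomial.X) = Polynomial.X ^ 2 * (a * b * (1 + Polynomial.X * c)) by ring, mul_pow (Polynomial.X ^ 2), ← pow_mul]
      ring
    · rw [pow_add]; ring
  have e4 := mul_left_cancel₀ (pow_ne_zero _ Polynomial.X_ne_zero) e3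
  have e5 := congrArg (Polynomial.coeff · 0) e4
  simp only [Polynomial.mul_coeff_zero, Polynomial.coeff_X_pow] at e5
  rw [if_neg (by omega), zero_mul, mul_eq_zero] at e5
  rcases e5 with e5 | e5
  · rw [← Polynomial.constantCoeff_apply, map_pow] at e5
    simp [ha, hb] at e5
  · exact hf0 e5

lemma dvd_monomial {b : MvPolynomial (Fin 3) k} {N : ℕ} (hb : b ∣ (X 0 * X 1 * X 2) ^ N) (hu : ¬ IsUnit b) : ∃ i : Fin 3, X i ∣ b := by
  obtain ⟨p, hp, hpb⟩ := WfDvdMonoid.exists_irreducible_factor hu (by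
    rintro rfl
    have := zero_dvd_iff.1 hb
    exact pow_ne_zero _ (mul_ne_zero (mul_ne_zero (X_ne_zero _) (X_ne_zero _)) (X_ne_zero _)) this)
  have h1 := hp.prime.dvd_of_dvd_pow (hpb.trans hb)
  have key : ∀ i : Fin 3, p ∣ X i → X i ∣ b := fun i hi => by
    have := (hp.associated_of_dvd (X_prime (R := k) (i := i)).irreducible hi)
    exact this.symm.dvd.trans hpb
  rcases hp.prime.dvd_or_dvd h1 with h2 | h2
  · rcases hp.prime.dvd_or_dvd h2 with h3 | h3
    · exact ⟨0, key _ h3⟩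
    · exact ⟨1, key _ h3⟩
  · exact ⟨2, key _ h2⟩

lemma not_X (h : Exc F G n r) (i : Fin 3) : ¬ X i ∣ G := by
  fin_cases i
  · exact h.not_X0
  · exact h.not_X1
  · exact h.not_X2

lemma factor_unit (h : Exc F G n r) {a b : MvPolynomial (Fin 3) k} (hab : G = a * b) (hFa : F ∣ bind₁ (stdQuad k) a) : IsUnit b := by
  by_contra hu
  have hG := h.homG
  have hG0 := h.G0
  rw [hab, mul_comm] at hG hG0
  obtain ⟨d, hd⟩ := homog_of_mul hG hG0
  obtain ⟨w, hw⟩ := hFa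
  have e := h.quadG
  rw [hab, map_mul, hw] at e
  have e2 : w * bind₁ (stdQuad k) b = X 0 ^ (n - r) * X 1 ^ (n - r) * X 2 ^ n := by
    apply mul_left_cancel₀ h.hFi.ne_zero
    rw [← mul_assoc, e]; ring
  have e3 : bind₁ (stdQuad k) b ∣ (X 0 * X 1 * X 2) ^ n := by
    refine (Dvd.intro_left _ e2).trans ?_
    rw [mul_pow, mul_pow]
    exact mul_dvd_mul (mul_dvd_mul (pow_dvd_pow _ (by omega)) (pow_dvd_pow _ (by omega))) dvd_rfl
  have e4 : b ∣ (X 0 * X 1 * X 2) ^ (2 * n) := by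
    have e5 := map_dvd (bind₁ (stdQuad k)) e3
    rw [quad_quad hd] at e5
    refine (Dvd.intro_left _ rfl).trans (e5.trans (dvd_of_eq ?_))
    rw [map_pow, map_mul, map_mul, bind₁_X_right, bind₁_X_right, bind₁_X_right]
    simp [stdQuad]; ring
  obtain ⟨i, hi⟩ := dvd_monomial e4 hu
  exact h.not_X i (hi.trans (hab ▸ Dvd.intro_left _ rfl))

lemma irrG (h : Exc F G n r) : Irreducible G := by
  refine ⟨?_, ?_⟩
  · intro hu
    have h1 := h.quadG
    have h2 : IsUnit (bind₁ (stdQuad k) G) := hu.map _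
    rw [h1] at h2
    exact h.hFi.not_isUnit (isUnit_of_mul_isUnit_right h2)
  · intro a b hab
    have h1 : F ∣ bind₁ (stdQuad k) G := ⟨_, h.quadG.trans (mul_comm _ _)⟩
    rw [hab, map_mul] at h1
    rcases h.hFi.prime.dvd_or_dvd h1 with h2 | h2
    · exact Or.inr (h.factor_unit hab h2)
    · exact Or.inl (h.factor_unit (hab.trans (mul_comm _ _)) h2)

lemma n2 (h : Exc F G n r) : 2 ≤ n := h.hr.trans h.rn

lemma trans (h : Exc F G n r) (A : Matrix.GeneralLinearGroup (Fin 3) k) :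
    ∃ φ, IsQuadTrans φ ∧ TransformsInto φ (bind₁ (linMap A) F) G := by
  refine ⟨_, ⟨1, A, rfl⟩, bind₁ (linMap A) (X 0 ^ (n - r) * X 1 ^ (n - r) * X 2 ^ n), ?_, ?_⟩
  · have : compMap (linMap 1) (compMap (stdQuad k) (linMap A)) = fun i => bind₁ (linMap A) (stdQuad k i) := by
      ext1 i
      simp only [compMap, linMap_one, bind₁_X_right]
    rw [this, ← bind₁_bind₁, h.quadG, map_mul, mul_comm]
  · intro hd
    have h2 := map_dvd (bind₁ (linMap A⁻¹)) hd
    rw [bind₁_linMap_mul, bind₁_linMap_mul, mul_inv_cancel, bind₁_linMap_one, bind₁_linMap_one] at h2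
    have key : ∀ (i : Fin 3) (N : ℕ), ¬ F ∣ X i ^ N := fun i N hN =>
      not_dvd_of_degree h.hF h.hFi.ne_zero (isHomogeneous_X k i) (X_ne_zero _) (by have := h.n2; omega) (h.hFi.prime.dvd_of_dvd_pow hN)
    rcases h.hFi.prime.dvd_or_dvd h2 with h3 | h3
    · rcases h.hFi.prime.dvd_or_dvd h3 with h4 | h4
      · exact key _ _ h4
      · exact key _ _ h4
    · exact key _ _ h3
end Exc


lemma sep_split [IsAlgClosed k] {f : Polynomial k} {d : ℕ} (hf : f.Separable) (hd : f.natDegree = d) :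
    ∃ (c : k) (γ : Fin d → k), c ≠ 0 ∧ Function.Injective γ ∧ ∀ t, f.eval t = c * ∏ i, (t - γ i) := by
  classical
  have hs := IsAlgClosed.splits f
  have hf0 : f ≠ 0 := hf.ne_zero
  have hcard : f.roots.card = d := by rw [← hd]; exact hs.natDegree_eq_card_roots.symm
  have hnd : f.roots.Nodup := Polynomial.nodup_roots hf
  have hc2 : f.roots.toFinset.card = d := by rw [Multiset.toFinset_card_of_nodup hnd, hcard]
  let e := (Finset.equivFinOfCardEq hc2).symm
  refine ⟨f.leadingCoeff, fun i => (e i : k), Polynomial.leadingCoeff_ne_zero.2 hf0, ?_, ?_⟩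
  · intro i j hij
    exact e.injective (Subtype.ext hij)
  · intro t
    have h1 := hs.eq_prod_roots
    conv_lhs => rw [h1]
    rw [Polynomial.eval_mul, Polynomial.eval_C, Polynomial.eval_multiset_prod, Multiset.map_map]
    congr 1
    have h2 : f.roots = f.roots.toFinset.val := by rw [Multiset.toFinset_val, Multiset.dedup_eq_self.2 hnd]
    have h3 : (Multiset.map (Polynomial.eval t ∘ fun x => Polynomial.X - Polynomial.C x) f.roots).prod =
        ∏ x ∈ f.roots.toFinset, (t - x) := by
      rw [Finset.prod, ← h2]; simp [Function.comp_def]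
    rw [h3, ← Finset.prod_coe_sort, ← Equiv.prod_comp e]

lemma form_lines [IsAlgClosed k] [CharZero k] {F H : MvPolynomial (Fin 3) k} {s d : ℕ} (hF : F.IsHomogeneous (s + d)) (a b : Fin 3) (hab : a ≠ b)
    (u p : Fin 3 → k) (hH : ∀ v : Fin 3 → k, v a ^ s * eval v H = eval (v a • u + v b • p) F)
    (hf : (rayAt p u F).Separable) (hd : (rayAt p u F).natDegree = d) : H ≠ 0 ∧ DistinctLines d H := by
  obtain ⟨c, γ, hc, hγ, h⟩ := sep_split hf hd
  have hL : ∀ i (v : Fin 3 → k), ∑ j, (Pi.single b 1 - γ i • Pi.single a 1 : Fin 3 → k) j * v j = v b - γ i * v a := by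
    intro i v
    simp [sub_mul, Finset.sum_sub_distrib, Pi.single_apply]
  suffices hs : H = C c * ∏ i, ∑ j, C ((Pi.single b 1 - γ i • Pi.single a 1 : Fin 3 → k) j) * X j by
    refine ⟨fun h0 => ?_, c, fun i => Pi.single b 1 - γ i • Pi.single a 1, hc, ?_, hs⟩
    · have h1 := congrArg (eval (Pi.single b 1)) hs
      rw [h0] at h1
      simp only [map_mul, eval_X, map_prod, eval_C, map_sum, hL] at h1
      simp [hab] at h1
      exact hc h1.symm
    rintro i j hij ⟨t, ht⟩
    have h1 := congrFun ht b
    have h2 := congrFun ht a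
    simp [hab, hab.symm] at h1 h2
    rw [← h1] at h2
    simp at h2
    exact hij (hγ h2).symm
  · apply mul_left_cancel₀ (X_ne_zero (R := k) a)
    apply MvPolynomial.funext
    intro v
    simp only [map_mul, eval_X, map_prod, eval_C, map_sum, hL]
    by_cases hv : v a = 0
    · simp [hv]
    · congr 1
      have h1 := hH v
      have h2 : v a • u + v b • p = v a • (u + (v b / v a) • p) := by
        rw [smul_add, smul_smul, mul_div_cancel₀ _ hv]
      rw [h2, Exc.eval_homog hF, ← rayAt_eval, h, pow_add, mul_assoc] at h1
      rw [mul_left_cancel₀ (pow_ne_zero _ hv) h1]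
      rw [mul_left_comm]
      congr 1
      have h3 : v a ^ d = ∏ i : Fin d, v a := by simp
      rw [h3, ← Finset.prod_mul_distrib]
      refine Finset.prod_congr rfl fun i _ => ?_
      field_simp

lemma vertex_aux {u g s : Polynomial (MvPolynomial (Fin 3) k)} {n : ℕ} (h : u * g = Polynomial.X ^ n * s) (hu : u.coeff 0 ≠ 0) :
    Polynomial.X ^ n ∣ g ∧ u.coeff 0 * g.coeff n = s.coeff 0 := by
  have h1 : Polynomial.X ^ n ∣ g := by
    refine Polynomial.prime_X.pow_dvd_of_dvd_mul_left n ?_ ⟨s, h⟩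
    rwa [Polynomial.X_dvd_iff]
  refine ⟨h1, ?_⟩
  obtain ⟨w, rfl⟩ := h1
  have h2 : u * w = s := by
    apply mul_left_cancel₀ (pow_ne_zero n Polynomial.X_ne_zero)
    rw [← h]; ring
  rw [← h2]
  simp [Polynomial.mul_coeff_zero, Polynomial.coeff_X_pow_mul']

lemma eval_bind (q : Fin 3 → MvPolynomial (Fin 3) k) (F : MvPolynomial (Fin 3) k) (v : Fin 3 → k) :
    eval v (bind₁ q F) = eval (fun i => eval v (q i)) F := eval₂Hom_bind₁ _ _ _ _

namespace Exc
variable {F G : MvPolynomial (Fin 3) k} {n r : ℕ}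

lemma ver2 [IsAlgClosed k] [CharZero k] (h : Exc F G n r) : Polynomial.X ^ n ∣ tay (Pi.single 2 1) G ∧
    (tay (Pi.single 2 1) G).coeff n ≠ 0 ∧ DistinctLines n ((tay (Pi.single 2 1) G).coeff n) := by
  have h1 := tay_vertex 2 _ tay_single_quad2 h.hF
  rw [h.hG, map_mul] at h1
  have hu : (tay (Pi.single 2 1) (X 2 ^ r : MvPolynomial (Fin 3) k)).coeff 0 = 1 := by
    rw [tay_coeff_zero]; simp
  obtain ⟨h2, h3⟩ := vertex_aux h1 (by rw [hu]; exact one_ne_zero)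
  refine ⟨h2, ?_⟩
  rw [hu, one_mul, coeff_zero_aeval] at h3
  refine form_lines (s := 0) (d := n) (F := F) (by simpa using h.hF) 0 1 (by decide) (Pi.single 1 1) (Pi.single 0 1) ?_ h.f3 h.f3d
  intro v
  rw [h3, eval_bind, pow_zero, one_mul]
  refine congrArg (fun q => eval q F) ?_
  ext i
  fin_cases i <;> simp [Polynomial.mul_coeff_zero]

lemma ver0 [IsAlgClosed k] [CharZero k] (h : Exc F G n r) : Polynomial.X ^ (n - r) ∣ tay (Pi.single 0 1) G ∧
    (tay (Pi.single 0 1) G).coeff (n - r) ≠ 0 ∧ DistinctLines (n - r) ((tay (Pi.single 0 1) G).coeff (n - r)) := by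
  have hrn := h.rn
  have h1 := tay_vertex 0 _ tay_single_quad0 h.hF
  have hu : (tay (Pi.single 0 1) (X 2 ^ r : MvPolynomial (Fin 3) k)) = Polynomial.X ^ r * Polynomial.C (X 2 ^ r) := by
    rw [map_pow, tay_X]; simp; ring
  have hn : Polynomial.X ^ n = (Polynomial.X ^ r * Polynomial.X ^ (n - r) : Polynomial (MvPolynomial (Fin 3) k)) := by
    rw [← pow_add]; congr 1; omega
  rw [h.hG, map_mul, hu, hn, mul_assoc, mul_assoc] at h1
  obtain ⟨h2, h3⟩ := vertex_aux (mul_left_cancel₀ (pow_ne_zero _ Polynomial.X_ne_zero) h1) (by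
    rw [Polynomial.coeff_C_zero]; exact pow_ne_zero _ (X_ne_zero _))
  refine ⟨h2, ?_⟩
  rw [Polynomial.coeff_C_zero, coeff_zero_aeval] at h3
  refine form_lines (s := r) (d := n - r) (F := F) (by convert h.hF using 1; omega) 2 1 (by decide) (Pi.single 1 1) (Pi.single 2 1) ?_ h.f2 h.f2d
  intro v
  have h4 := congrArg (eval v) h3
  rw [map_mul, map_pow, eval_X, eval_bind] at h4
  rw [h4]
  refine congrArg (fun q => eval q F) ?_
  ext i
  fin_cases i <;> simp [Polynomial.mul_coeff_zero]

lemma ver1 [IsAlgClosed k] [CharZero k] (h : Exc F G n r) : Polynomial.X ^ (n - r) ∣ tay (Pi.single 1 1) G ∧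
    (tay (Pi.single 1 1) G).coeff (n - r) ≠ 0 ∧ DistinctLines (n - r) ((tay (Pi.single 1 1) G).coeff (n - r)) := by
  have hrn := h.rn
  have h1 := tay_vertex 1 _ tay_single_quad1 h.hF
  have hu : (tay (Pi.single 1 1) (X 2 ^ r : MvPolynomial (Fin 3) k)) = Polynomial.X ^ r * Polynomial.C (X 2 ^ r) := by
    rw [map_pow, tay_X]; simp; ring
  have hn : Polynomial.X ^ n = (Polynomial.X ^ r * Polynomial.X ^ (n - r) : Polynomial (MvPolynomial (Fin 3) k)) := by
    rw [← pow_add]; congr 1; omega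
  rw [h.hG, map_mul, hu, hn, mul_assoc, mul_assoc] at h1
  obtain ⟨h2, h3⟩ := vertex_aux (mul_left_cancel₀ (pow_ne_zero _ Polynomial.X_ne_zero) h1) (by
    rw [Polynomial.coeff_C_zero]; exact pow_ne_zero _ (X_ne_zero _))
  refine ⟨h2, ?_⟩
  rw [Polynomial.coeff_C_zero, coeff_zero_aeval] at h3
  refine form_lines (s := r) (d := n - r) (F := F) (by convert h.hF using 1; omega) 2 0 (by decide) (Pi.single 0 1) (Pi.single 2 1) ?_ h.f1 h.f1d
  intro v
  have h4 := congrArg (eval v) h3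
  rw [map_mul, map_pow, eval_X, eval_bind] at h4
  rw [h4]
  refine congrArg (fun q => eval q F) ?_
  ext i
  fin_cases i <;> simp [Polynomial.mul_coeff_zero]

lemma not_nonOrd_of {v : Fin 3 → k} {m : ℕ} (hd : Polynomial.X ^ m ∣ tay v G) (hl : (tay v G).coeff m ≠ 0 ∧ DistinctLines m ((tay v G).coeff m)) : ¬ NonOrd G v := by
  rintro ⟨-, h2, M, hM, hM0, hMl⟩
  have : m = M := le_antisymm (order_le hd hM0) (order_le hM hl.1)
  subst this
  exact hMl hl.2

/-- Jacobian. -/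
def jac (v : Fin 3 → k) : Matrix (Fin 3) (Fin 3) k := !![0, v 2, v 1; v 2, 0, v 0; v 1, v 0, 0]

lemma jac_det (v : Fin 3 → k) : (jac v).det = 2 * v 0 * v 1 * v 2 := by
  simp [jac, Matrix.det_fin_three]; ring

def Qv (v : Fin 3 → k) : Fin 3 → k := ![v 1 * v 2, v 0 * v 2, v 0 * v 1]

lemma loc [CharZero k] (h : Exc F G n r) (v : Fin 3 → k) (hv : ∀ i, v i ≠ 0) : LocEq F (Qv v) G v := by
  have hJ : (jac v).det ≠ 0 := by
    rw [jac_det]; exact mul_ne_zero (mul_ne_zero (mul_ne_zero two_ne_zero (hv 0)) (hv 1)) (hv 2)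
  let A := Matrix.GeneralLinearGroup.mkOfDetNeZero (jac v) hJ
  have hA : (A : Matrix (Fin 3) (Fin 3) k) = jac v := rfl
  refine ⟨A, (v 2 ^ r)⁻¹, inv_ne_zero (pow_ne_zero _ (hv 2)), fun m hm => ?_⟩
  let q : Fin 3 → Polynomial (MvPolynomial (Fin 3) k) := fun i =>
    Polynomial.C (linMap A i) + Polynomial.X * Polynomial.C (stdQuad k i)
  have hq : ∀ i, tay v (stdQuad k i) = Polynomial.C (C (Qv v i)) + Polynomial.X * q i := by
    intro i
    fin_cases i <;> simp [stdQuad, tay_X, Qv, q, linMap, hA, jac, Fin.sum_univ_three] <;> ring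
  obtain ⟨h1, h2⟩ := tay_comp (Qv v) v (stdQuad k) q hq F m hm
  rw [h.hG, map_mul] at h1 h2
  have hu : (tay v (X 2 ^ r : MvPolynomial (Fin 3) k)).coeff 0 = C (v 2 ^ r) := by
    rw [tay_coeff_zero]; simp
  obtain ⟨s, hs⟩ := h1
  obtain ⟨h3, h4⟩ := vertex_aux hs (by rw [hu]; exact C_ne_zero.2 (pow_ne_zero _ (hv 2)))
  refine ⟨h3, ?_⟩
  have e : (fun i => (q i).coeff 0) = linMap A := by ext1 i; simp [q]
  rw [e, hs] at h2
  rw [← h2]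
  have e2 : (Polynomial.X ^ m * s).coeff m = s.coeff 0 := by simp [Polynomial.coeff_X_pow_mul']
  rw [e2, ← h4, hu, ← mul_assoc, ← C_mul, inv_mul_cancel₀ (pow_ne_zero _ (hv 2)), C_1, one_mul]
end Exc


lemma tay_map_eval (v u : Fin 3 → k) (F : MvPolynomial (Fin 3) k) (t : k) :
    ((tay v F).map (eval u)).eval t = eval (v + t • u) F := by
  have : ((Polynomial.evalRingHom t).comp ((Polynomial.mapRingHom (eval u)).comp (tay v : MvPolynomial (Fin 3) k →+* _))) =
    eval (v + t • u) := by
    apply MvPolynomial.ringHom_ext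
    · intro a; simp [tay, Polynomial.algebraMap_apply, algebraMap_eq]
    · intro i; simp [tay]; ring
  exact congrArg (fun f => f F) this

lemma ray_smooth [CharZero k] (p u : Fin 3 → k) (F : MvPolynomial (Fin 3) k) (c : k) (hs : (rayAt p u F).Separable) :
    ¬ Polynomial.X ^ 2 ∣ tay (u + c • p) F := by
  intro hd
  have h1 : Polynomial.taylor c (rayAt p u F) = (tay (u + c • p) F).map (eval p) := by
    apply Polynomial.funext
    intro t
    rw [tay_map_eval, Polynomial.taylor_eval, rayAt_eval]
    refine congrArg (fun q => eval q F) ?_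
    rw [add_smul]; abel
  have h2 := Polynomial.X_pow_dvd_iff.1 hd
  have h3 := congrArg (Polynomial.coeff · 0) h1
  have h4 := congrArg (Polynomial.coeff · 1) h1
  simp only [Polynomial.taylor_coeff_zero, Polynomial.taylor_coeff_one, Polynomial.coeff_map] at h3 h4
  rw [h2 0 (by omega), map_zero] at h3
  rw [h2 1 (by omega), map_zero] at h4
  have h5 := hs.aeval_derivative_ne_zero (x := c) (by simpa using h3)
  exact h5 (by simpa using h4)

namespace Exc
variable {F G : MvPolynomial (Fin 3) k} {n r : ℕ}

lemma tri_smooth [CharZero k] (h : Exc F G n r) {w : Fin 3 → k} (hd : Polynomial.X ^ 2 ∣ tay w F) (hw : ∃ i, w i = 0) :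
    w 0 = 0 ∧ w 1 = 0 := by
  by_contra hc
  have key : ∀ (a : k) (u p : Fin 3 → k) (c : k), a ≠ 0 → w = a • (u + c • p) → (rayAt p u F).Separable → False := by
    intro a u p c ha hwa hs
    apply ray_smooth p u F c hs
    rw [(locEq_scale h.hF (u + c • p) a ha).dvd h.hFi.ne_zero, ← hwa]
    exact hd
  by_cases h0 : w 0 = 0
  · have h1 : w 1 ≠ 0 := fun h1 => hc ⟨h0, h1⟩
    refine key (w 1) _ _ (w 2 / w 1) h1 ?_ h.f2
    ext i; fin_cases i <;> simp [h0] <;> field_simp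
  · by_cases h1 : w 1 = 0
    · refine key (w 0) _ _ (w 2 / w 0) h0 ?_ h.f1
      ext i; fin_cases i <;> simp [h1] <;> field_simp
    · have h2 : w 2 = 0 := by
        obtain ⟨i, hi⟩ := hw
        fin_cases i
        · exact (h0 hi).elim
        · exact (h1 hi).elim
        · exact hi
      refine key (w 1) _ _ (w 0 / w 1) h1 ?_ h.f3
      ext i; fin_cases i <;> simp [h2] <;> field_simp

lemma not_nonOrd_vertex [IsAlgClosed k] [CharZero k] (h : Exc F G n r) (j : Fin 3) (c : k) (hc : c ≠ 0) : ¬ NonOrd G (c • Pi.single j 1) := by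
  intro hn
  have h1 := (locEq_scale h.homG (Pi.single j 1) c hc).nonOrd h.G0 (by simp) hn
  fin_cases j
  · exact not_nonOrd_of h.ver0.1 h.ver0.2 h1
  · exact not_nonOrd_of h.ver1.1 h.ver1.2 h1
  · exact not_nonOrd_of h.ver2.1 h.ver2.2 h1

lemma nonOrd_cases [IsAlgClosed k] [CharZero k] (h : Exc F G n r) {v : Fin 3 → k} (hn : NonOrd G v) :
    (∀ i, v i ≠ 0) ∨ (v 2 = 0 ∧ v 0 ≠ 0 ∧ v 1 ≠ 0) := by
  have hv := hn.1
  have h2 := hn.2.1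
  have hev : eval v G = 0 := by
    have := Polynomial.X_pow_dvd_iff.1 h2 0 (by omega)
    rw [tay_coeff_zero] at this
    simpa using this
  have key : ∀ (j : Fin 3) (c : k), v = c • Pi.single j 1 → False := by
    intro j c hvc
    have hc : c ≠ 0 := by rintro rfl; simp at hvc; exact hv hvc
    exact h.not_nonOrd_vertex j c hc (hvc ▸ hn)
  by_cases h0 : v 0 = 0
  · exfalso
    by_cases h1 : v 1 = 0
    · refine key 2 (v 2) ?_
      ext i; fin_cases i <;> simp [h0, h1]
    · by_cases h2 : v 2 = 0
      · refine key 1 (v 1) ?_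
        ext i; fin_cases i <;> simp [h0, h2]
      · exact h.side0 v h0 h1 h2 hev
  · by_cases h1 : v 1 = 0
    · exfalso
      by_cases h2 : v 2 = 0
      · refine key 0 (v 0) ?_
        ext i; fin_cases i <;> simp [h1, h2]
      · exact h.side1 v h1 h0 h2 hev
    · by_cases h2 : v 2 = 0
      · exact Or.inr ⟨h2, h0, h1⟩
      · left; intro i; fin_cases i <;> assumption

lemma Qv_Qv (w : Fin 3 → k) : Qv (Qv w) = (w 0 * w 1 * w 2) • w := by
  ext i; fin_cases i <;> simp [Qv] <;> ring

lemma Qv_ne {w : Fin 3 → k} (hw : ∀ i, w i ≠ 0) (i : Fin 3) : Qv w i ≠ 0 := by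
  have h0 := hw 0
  have h1 := hw 1
  have h2 := hw 2
  fin_cases i <;> simp [Qv, *]

lemma Qv_smul (c : k) (w : Fin 3 → k) : Qv (c • w) = c ^ 2 • Qv w := by
  ext i; fin_cases i <;> simp [Qv] <;> ring

lemma Qv_prop {w w' : Fin 3 → k} (hw : ∀ i, w i ≠ 0) {c : k} (h : Qv w = c • Qv w') : ∃ d : k, w = d • w' := by
  have h1 := congrArg Qv h
  rw [Qv_smul, Qv_Qv, Qv_Qv] at h1
  have h2 : w 0 * w 1 * w 2 ≠ 0 := mul_ne_zero (mul_ne_zero (hw 0) (hw 1)) (hw 2)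
  refine ⟨(w 0 * w 1 * w 2)⁻¹ * (c ^ 2 * (w' 0 * w' 1 * w' 2)), ?_⟩
  rw [mul_smul, mul_smul, ← h1, smul_smul, inv_mul_cancel₀ h2, one_smul]

lemma off_dvd [CharZero k] (h : Exc F G n r) {w : Fin 3 → k} (hw : ∀ i, w i ≠ 0) (m : ℕ) (hm : Polynomial.X ^ m ∣ tay w F) :
    Polynomial.X ^ m ∣ tay (Qv w) G := by
  rw [← (h.loc (Qv w) (Qv_ne hw)).dvd h.hFi.ne_zero, Qv_Qv, ← (locEq_scale h.hF w _ _).dvd h.hFi.ne_zero]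
  · exact hm
  · exact mul_ne_zero (mul_ne_zero (hw 0) (hw 1)) (hw 2)

lemma off_nonOrd [CharZero k] (h : Exc F G n r) {v : Fin 3 → k} (hv : ∀ i, v i ≠ 0) (hn : NonOrd G v) : NonOrd F (Qv v) := by
  refine (h.loc v hv).nonOrd h.hFi.ne_zero ?_ hn
  intro h0
  exact Qv_ne hv 0 (by rw [h0]; rfl)
end Exc

lemma nonOrd_lin (A : Matrix.GeneralLinearGroup (Fin 3) k) {F : MvPolynomial (Fin 3) k} (hF : F ≠ 0) {v : Fin 3 → k}
    (h : NonOrd (bind₁ (linMap A) F) v) : NonOrd F ((A : Matrix (Fin 3) (Fin 3) k).mulVec v) := by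
  refine (locEq_lin A F v).nonOrd hF ?_ h
  intro h0
  apply h.1
  have h1 := congrArg (((A⁻¹ : Matrix.GeneralLinearGroup (Fin 3) k) : Matrix (Fin 3) (Fin 3) k).mulVec) h0
  rw [Matrix.mulVec_mulVec, ← Units.val_mul, inv_mul_cancel] at h1
  simpa using h1

lemma eval_lin (A : Matrix.GeneralLinearGroup (Fin 3) k) (F : MvPolynomial (Fin 3) k) (v : Fin 3 → k) :
    eval v (bind₁ (linMap A) F) = eval ((A : Matrix (Fin 3) (Fin 3) k).mulVec v) F := by
  rw [eval_bind]
  refine congrArg (fun q => eval q F) ?_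
  ext i; exact linMap_eval A v i

lemma rayAt_lin [CharZero k] (A : Matrix.GeneralLinearGroup (Fin 3) k) (F : MvPolynomial (Fin 3) k) (p u : Fin 3 → k) :
    rayAt p u (bind₁ (linMap A) F) = rayAt ((A : Matrix (Fin 3) (Fin 3) k).mulVec p) ((A : Matrix (Fin 3) (Fin 3) k).mulVec u) F := by
  apply Polynomial.funext
  intro t
  rw [rayAt_eval, rayAt_eval, eval_lin, Matrix.mulVec_add, Matrix.mulVec_smul]

lemma exists_exc [CharZero k] {F : MvPolynomial (Fin 3) k} {n : ℕ} (hF : F.IsHomogeneous n) (hFi : Irreducible F)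
    {P : Fin 3 → k} (hP : NonOrd F P) : ∃ (A : Matrix.GeneralLinearGroup (Fin 3) k) (G : MvPolynomial (Fin 3) k) (r : ℕ),
      Exc (bind₁ (linMap A) F) G n r ∧ NonOrd (bind₁ (linMap A) F) (Pi.single 2 1) := by
  obtain ⟨r, hr, hr0⟩ := exists_order P hFi.ne_zero
  have hr2 : 2 ≤ r := order_le hP.2.1 hr0
  obtain ⟨D, hD0, hD⟩ := sep_claim P hF hFi hr hr0
  -- u1 outside
  obtain ⟨i0, hi0⟩ : ∃ i, P i ≠ 0 := by
    by_contra! hc; exact hP.1 (funext hc)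
  obtain ⟨u1, hu1⟩ := exists_eval_ne (mul_ne_zero hD0 hFi.ne_zero)
  rw [map_mul] at hu1
  have hu1D := left_ne_zero_of_mul hu1
  have hu1F := right_ne_zero_of_mul hu1
  have ht0 : (tay u1 F).coeff 0 ≠ 0 := by rw [tay_coeff_zero]; exact C_ne_zero.2 hu1F
  obtain ⟨D1, hD10, hD1⟩ := sep_claim u1 hF hFi (r := 0) (by simp) ht0
  have hPF : eval P F = 0 := by
    have := Polynomial.X_pow_dvd_iff.1 hr 0 (by omega)
    rw [tay_coeff_zero] at this
    simpa using this
  -- determinant polynomial, linear in u2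
  let M : (Fin 3 → k) → Matrix (Fin 3) (Fin 3) k := fun u => Matrix.of ![![u1 0, u 0, P 0], ![u1 1, u 1, P 1], ![u1 2, u 2, P 2]]
  let dp : MvPolynomial (Fin 3) k := C (u1 2 * P 1 - u1 1 * P 2) * X 0 + C (u1 0 * P 2 - u1 2 * P 0) * X 1 + C (u1 1 * P 0 - u1 0 * P 1) * X 2
  have hdp : ∀ u, eval u dp = (M u).det := by
    intro u
    simp [dp, M, Matrix.det_fin_three]; ring
  have hdp0 : dp ≠ 0 := by
    intro h0
    have e : ∀ j, eval (Pi.single j 1) dp = 0 := fun j => by rw [h0]; simp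
    have e0 := e 0
    have e1 := e 1
    have e2 := e 2
    simp [dp] at e0 e1 e2
    have hprop : u1 = (u1 i0 / P i0) • P := by
      ext j
      simp only [Pi.smul_apply, smul_eq_mul]
      rw [div_mul_eq_mul_div, eq_div_iff hi0]
      fin_cases i0 <;> fin_cases j <;> simp <;> first | linear_combination e0 | linear_combination e1 | linear_combination e2 | linear_combination -e0 | linear_combination -e1 | linear_combination -e2
    apply hu1F
    rw [hprop, Exc.eval_homog hF, hPF, mul_zero]
  obtain ⟨u2, hu2⟩ := exists_eval_ne (mul_ne_zero (mul_ne_zero hdp0 hFi.ne_zero) (mul_ne_zero hD0 hD10))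
  simp only [map_mul] at hu2
  have hdet : (M u2).det ≠ 0 := by rw [← hdp]; exact left_ne_zero_of_mul (left_ne_zero_of_mul hu2)
  have hu2F := right_ne_zero_of_mul (left_ne_zero_of_mul hu2)
  have hu2D := left_ne_zero_of_mul (right_ne_zero_of_mul hu2)
  have hu2D1 := right_ne_zero_of_mul (right_ne_zero_of_mul hu2)
  let A := Matrix.GeneralLinearGroup.mkOfDetNeZero (M u2) hdet
  have hA : (A : Matrix (Fin 3) (Fin 3) k) = M u2 := rfl
  have c0 : (A : Matrix (Fin 3) (Fin 3) k).mulVec (Pi.single 0 1) = u1 := by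
    rw [hA]; ext i; fin_cases i <;> simp [M]
  have c1 : (A : Matrix (Fin 3) (Fin 3) k).mulVec (Pi.single 1 1) = u2 := by
    rw [hA]; ext i; fin_cases i <;> simp [M]
  have c2 : (A : Matrix (Fin 3) (Fin 3) k).mulVec (Pi.single 2 1) = P := by
    rw [hA]; ext i; fin_cases i <;> simp [M]
  have hloc := locEq_lin A F (Pi.single 2 1)
  rw [c2] at hloc
  have hco := hloc.coeff_ne hr hr0
  have hF'h := homog_lin A hF
  obtain ⟨G, hG⟩ := exists_transform hF'h hco.1
  refine ⟨A, G, r, ⟨hF'h, irreducible_lin A hFi, hr2, hco.1, hco.2, ?_, ?_, ?_, ?_, ?_, ?_, ?_, ?_, hG⟩, ?_⟩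
  · rw [eval_lin, c0]; exact hu1F
  · rw [eval_lin, c1]; exact hu2F
  · rw [rayAt_lin, c0, c2]; exact (hD _ hu1D).1
  · rw [rayAt_lin, c0, c2]; exact (hD _ hu1D).2
  · rw [rayAt_lin, c1, c2]; exact (hD _ hu2D).1
  · rw [rayAt_lin, c1, c2]; exact (hD _ hu2D).2
  · rw [rayAt_lin, c0, c1]; exact (hD1 _ hu2D1).1
  · rw [rayAt_lin, c0, c1]; exact (hD1 _ hu2D1).2
  · have h1 : NonOrd (bind₁ (linMap A⁻¹) (bind₁ (linMap A) F)) P := by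
      rw [bind₁_linMap_mul, mul_inv_cancel, bind₁_linMap_one]; exact hP
    have h2 := nonOrd_lin A⁻¹ (irreducible_lin A hFi).ne_zero h1
    rw [← c2, Matrix.mulVec_mulVec, ← Units.val_mul, inv_mul_cancel, Units.val_one, Matrix.one_mulVec] at h2
    exact h2


/-- Genus-defect bound. -/
def Gd (F : MvPolynomial (Fin 3) k) (n a : ℕ) : Prop :=
  ∃ (ι : Type) (_ : Fintype ι) (pts : ι → Fin 3 → k) (m : ι → ℕ), Cfg pts ∧
    (∀ i, Polynomial.X ^ (m i) ∣ tay (pts i) F) ∧ (n - 1) * (n - 2) ≤ ∑ i, m i * (m i - 1) + a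

/-- Bound on the number of non-ordinary points. -/
def Bd (F : MvPolynomial (Fin 3) k) (b : ℕ) : Prop :=
  ∀ (ι : Type) (_ : Fintype ι) (pts : ι → Fin 3 → k), Cfg pts → (∀ i, NonOrd F (pts i)) → Fintype.card ι ≤ b

lemma exists_Gd (F : MvPolynomial (Fin 3) k) (n : ℕ) : ∃ a, Gd F n a :=
  ⟨(n - 1) * (n - 2), Empty, inferInstance, Empty.elim, Empty.elim, ⟨fun i => i.elim, fun i => i.elim⟩, fun i => i.elim, by simp⟩

lemma exists_Bd [CharZero k] [IsAlgClosed k] {F : MvPolynomial (Fin 3) k} {n : ℕ} (hF : F.IsHomogeneous n) (hFi : Irreducible F) :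
    ∃ b, Bd F b := by
  refine ⟨(n - 1) * (n - 2), ?_⟩
  intro ι _ pts hp hn
  have := genus_bound hF hFi pts hp (fun _ => 2) (fun i => (hn i).2.1)
  simp at this
  omega

lemma inv_mulVec (A : Matrix.GeneralLinearGroup (Fin 3) k) (v : Fin 3 → k) :
    ((A⁻¹ : Matrix.GeneralLinearGroup (Fin 3) k) : Matrix (Fin 3) (Fin 3) k).mulVec ((A : Matrix (Fin 3) (Fin 3) k).mulVec v) = v := by
  rw [Matrix.mulVec_mulVec, ← Units.val_mul, inv_mul_cancel, Units.val_one, Matrix.one_mulVec]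

lemma cfg_lin (A : Matrix.GeneralLinearGroup (Fin 3) k) {ι : Type} {pts : ι → Fin 3 → k} (h : Cfg pts) :
    Cfg (fun i => (A : Matrix (Fin 3) (Fin 3) k).mulVec (pts i)) := by
  refine ⟨fun i h0 => h.1 i ?_, fun i j hij c hc => h.2 i j hij c ?_⟩
  · rw [← inv_mulVec A (pts i)]
    simp only at h0
    rw [h0, Matrix.mulVec_zero]
  · rw [← inv_mulVec A (pts i)]
    simp only at hc
    rw [hc, Matrix.mulVec_smul, inv_mulVec]

lemma Gd_lin (A : Matrix.GeneralLinearGroup (Fin 3) k) {F : MvPolynomial (Fin 3) k} {n a : ℕ} (hF : F ≠ 0) (h : Gd F n a) :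
    Gd (bind₁ (linMap A) F) n a := by
  obtain ⟨ι, _, pts, m, hp, hm, hs⟩ := h
  refine ⟨ι, inferInstance, _, m, cfg_lin A⁻¹ hp, fun i => ?_, hs⟩
  rw [← (locEq_lin A F _).dvd hF]
  have := inv_mulVec A⁻¹ (pts i)
  rw [inv_inv] at this
  rw [this]
  exact hm i

lemma Bd_lin (A : Matrix.GeneralLinearGroup (Fin 3) k) {F : MvPolynomial (Fin 3) k} {b : ℕ} (hF : F ≠ 0) (h : Bd F b) :
    Bd (bind₁ (linMap A) F) b := by
  intro ι _ pts hp hn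
  exact h ι inferInstance _ (cfg_lin A hp) (fun i => nonOrd_lin A hF (hn i))

lemma cfg_option {ι : Type} {pts : ι → Fin 3 → k} (h : Cfg pts) {v : Fin 3 → k} (hv : v ≠ 0) (h1 : ∀ i (c : k), pts i ≠ c • v) :
    Cfg (fun o : Option ι => o.elim v pts) := by
  have h2 : ∀ i (c : k), v ≠ c • pts i := by
    intro i c hc
    have hc0 : c ≠ 0 := by rintro rfl; simp at hc; exact hv hc
    apply h1 i c⁻¹
    rw [hc, smul_smul, inv_mul_cancel₀ hc0, one_smul]
  refine ⟨?_, ?_⟩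
  · rintro (_ | i)
    · exact hv
    · exact h.1 i
  · rintro (_ | i) (_ | j) hij c
    · exact (hij rfl).elim
    · exact h2 j c
    · exact h1 i c
    · exact h.2 i j (fun hh => hij (by rw [hh])) c

lemma arith1 {n r S a : ℕ} (hr : 2 ≤ r) (hrn : r ≤ n) (h : (n - 1) * (n - 2) ≤ S + r * (r - 1) + a) :
    (2 * n - r - 1) * (2 * n - r - 2) ≤ S + ((n - r) * (n - r - 1) + (n - r) * (n - r - 1) + n * (n - 1)) + a := by
  obtain ⟨s, rfl⟩ := Nat.exists_eq_add_of_le hrn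
  obtain ⟨t, rfl⟩ := Nat.exists_eq_add_of_le hr
  have e1 : 2 + t + s - 1 = t + s + 1 := by omega
  have e2 : 2 + t + s - 2 = t + s := by omega
  have e3 : 2 * (2 + t + s) - (2 + t) - 1 = t + 2 * s + 1 := by omega
  have e4 : 2 * (2 + t + s) - (2 + t) - 2 = t + 2 * s := by omega
  have e5 : 2 + t + s - (2 + t) = s := by omega
  have e6 : 2 + t - 1 = t + 1 := by omega
  rw [e1, e2, e6] at h
  rw [e3, e4, e5, e1]
  rcases s with _ | s
  · simp; nlinarith
  · simp only [Nat.add_sub_cancel]; nlinarith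

namespace Exc
variable {F G : MvPolynomial (Fin 3) k} {n r : ℕ}

lemma cfg_sum {ι : Type} {pts : ι → Fin 3 → k} (h : Cfg pts) :
    Cfg (Sum.elim (fun i : {i // ∀ j, pts i j ≠ 0} => Qv (pts i)) (fun j : Fin 3 => (Pi.single j 1 : Fin 3 → k))) := by
  have hq : ∀ i : {i // ∀ j, pts i j ≠ 0}, ∀ j, Qv (pts i) j ≠ 0 := fun i j => Qv_ne i.2 j
  have hz : ∀ j : Fin 3, ∃ l, (Pi.single j 1 : Fin 3 → k) l = 0 := by
    intro j; fin_cases j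
    · exact ⟨1, by simp⟩
    · exact ⟨0, by simp⟩
    · exact ⟨0, by simp⟩
  refine ⟨?_, ?_⟩
  · rintro (i | j)
    · intro h0; exact hq i 0 (congrFun h0 0)
    · simp
  · rintro (i | i) (j | j) hij c hc
    · simp only [Sum.elim_inl] at hc
      obtain ⟨d, hd⟩ := Qv_prop i.2 hc
      exact h.2 i j (fun hh => hij (by rw [Subtype.ext hh])) d hd
    · simp only [Sum.elim_inl, Sum.elim_inr] at hc
      obtain ⟨l, hl⟩ := hz j
      apply hq i l
      rw [hc, Pi.smul_apply, hl, smul_zero]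
    · simp only [Sum.elim_inl, Sum.elim_inr] at hc
      have hc0 : c ≠ 0 := by rintro rfl; simp at hc
      obtain ⟨l, hl⟩ := hz i
      rw [hc, Pi.smul_apply, smul_eq_mul] at hl
      exact mul_ne_zero hc0 (hq j l) hl
    · simp only [Sum.elim_inr] at hc
      have := congrFun hc i
      have hij' : i ≠ j := fun hh => hij (by rw [hh])
      simp [hij'] at this

lemma sum_bound [CharZero k] (h : Exc F G n r) {ι : Type} [Fintype ι] {pts : ι → Fin 3 → k} (hp : Cfg pts) (m : ι → ℕ)
    (hm : ∀ i, Polynomial.X ^ (m i) ∣ tay (pts i) F) [DecidablePred fun i => ∀ j, pts i j ≠ 0] :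
    ∑ i, m i * (m i - 1) ≤ ∑ i : {i // ∀ j, pts i j ≠ 0}, m i * (m i - 1) + r * (r - 1) := by
  rw [← Fintype.sum_subtype_add_sum_subtype (fun i => ∀ j, pts i j ≠ 0)]
  apply Nat.add_le_add_left
  have key : ∀ i : {i // ¬ ∀ j, pts i j ≠ 0}, m i * (m i - 1) ≠ 0 → pts i 0 = 0 ∧ pts i 1 = 0 := by
    intro i hi
    have h2 : 2 ≤ m i := by
      by_contra hc
      have : m i = 0 ∨ m i = 1 := by omega
      rcases this with h | h <;> rw [h] at hi <;> simp at hi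
    refine h.tri_smooth ((pow_dvd_pow _ h2).trans (hm i)) ?_
    have := i.2
    push Not at this
    exact this
  have form : ∀ i : {i // ¬ ∀ j, pts i j ≠ 0}, m i * (m i - 1) ≠ 0 → pts i 2 ≠ 0 ∧ pts i = pts i 2 • Pi.single 2 1 := by
    intro i hi
    obtain ⟨h0, h1⟩ := key i hi
    have e : pts i = pts i 2 • Pi.single 2 1 := by
      ext l; fin_cases l <;> simp [h0, h1]
    refine ⟨fun hz => hp.1 i ?_, e⟩
    rw [e, hz, zero_smul]
  by_cases hex : ∃ i0 : {i // ¬ ∀ j, pts i j ≠ 0}, m i0 * (m i0 - 1) ≠ 0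
  · obtain ⟨i0, hi0⟩ := hex
    obtain ⟨hc0, he0⟩ := form i0 hi0
    rw [Finset.sum_eq_single i0]
    · have hle : m i0 ≤ r := by
        refine order_le (p := tay (Pi.single 2 1) F) ?_ h.hc
        rw [(locEq_scale h.hF (Pi.single 2 1) _ hc0).dvd h.hFi.ne_zero, ← he0]
        exact hm i0
      exact Nat.mul_le_mul hle (by omega)
    · intro i _ hne
      by_contra hi
      obtain ⟨hc, he⟩ := form i hi
      apply hp.2 i i0 (fun hh => hne (Subtype.ext hh)) (pts i 2 * (pts i0 2)⁻¹)
      rw [he0, smul_smul]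
      conv_lhs => rw [he]
      simp [hc0]
    · simp
  · push Not at hex
    rw [Finset.sum_eq_zero (fun i _ => hex i)]
    exact Nat.zero_le _

lemma fam [IsAlgClosed k] [CharZero k] (h : Exc F G n r) {a : ℕ} (hg : Gd F n a) :
    ∃ (ι : Type) (_ : Fintype ι) (pts : ι → Fin 3 → k) (m : ι → ℕ), Cfg pts ∧
    (∀ i, Polynomial.X ^ (m i) ∣ tay (pts i) G) ∧ (2 * n - r - 1) * (2 * n - r - 2) ≤ ∑ i, m i * (m i - 1) + a ∧
    ∀ v : Fin 3 → k, v 2 = 0 → v 0 ≠ 0 → v 1 ≠ 0 → ∀ i (c : k), pts i ≠ c • v := by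
  classical
  obtain ⟨ι, _, pts, m, hp, hm, hs⟩ := hg
  refine ⟨{i // ∀ j, pts i j ≠ 0} ⊕ Fin 3, inferInstance, _, Sum.elim (fun i => m i) ![n - r, n - r, n], cfg_sum hp, ?_, ?_, ?_⟩
  · rintro (i | j)
    · exact h.off_dvd i.2 _ (hm i)
    · fin_cases j
      · exact h.ver0.1
      · exact h.ver1.1
      · exact h.ver2.1
  · rw [Fintype.sum_sum_type]
    simp only [Sum.elim_inl, Sum.elim_inr]
    rw [Fin.sum_univ_three]
    have := h.sum_bound hp m hm
    exact arith1 h.hr h.rn (by omega)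
  · rintro v h2 h0 h1 (i | j) c hc
    · have := congrFun hc 2
      simp [h2] at this
      exact Qv_ne i.2 2 this
    · simp only [Sum.elim_inr] at hc
      have e0 := congrFun hc 0
      have e1 := congrFun hc 1
      have e2 := congrFun hc 2
      fin_cases j <;> simp [h0, h1, h2] at e0 e1 e2
      · simp [e1] at e0
      · simp [e0] at e1

lemma gd_same [IsAlgClosed k] [CharZero k] (h : Exc F G n r) {a : ℕ} (hg : Gd F n a) : Gd G (2 * n - r) a := by
  obtain ⟨ι, _, pts, m, hp, hm, hs, -⟩ := h.fam hg
  exact ⟨ι, inferInstance, pts, m, hp, hm, hs⟩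

lemma gd_drop [IsAlgClosed k] [CharZero k] (h : Exc F G n r) {a : ℕ} (hg : Gd F n a) {v : Fin 3 → k} (h2 : v 2 = 0) (h0 : v 0 ≠ 0) (h1 : v 1 ≠ 0)
    (hd : Polynomial.X ^ 2 ∣ tay v G) : ∃ a' < a, Gd G (2 * n - r) a' := by
  obtain ⟨ι, _, pts, m, hp, hm, hs, hv⟩ := h.fam hg
  have hc := cfg_option hp (v := v) (fun hz => h0 (by rw [hz]; rfl)) (hv v h2 h0 h1)
  have hm' : ∀ o : Option ι, Polynomial.X ^ (o.elim 2 m) ∣ tay (o.elim v pts) G := by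
    rintro (_ | i)
    · exact hd
    · exact hm i
  have hg := genus_bound h.homG h.irrG _ hc (fun o => o.elim 2 m) hm'
  rw [Fintype.sum_option] at hg
  simp only [Option.elim] at hg
  refine ⟨a - 2, by omega, Option ι, inferInstance, _, (fun o => o.elim 2 m), hc, hm', ?_⟩
  rw [Fintype.sum_option]
  simp only [Option.elim]
  omega

lemma bd_drop [IsAlgClosed k] [CharZero k] (h : Exc F G n r) {b : ℕ} (hb : Bd F b) (he : NonOrd F (Pi.single 2 1))
    (hno : ∀ v : Fin 3 → k, v 2 = 0 → v 0 ≠ 0 → v 1 ≠ 0 → ¬ Polynomial.X ^ 2 ∣ tay v G) : ∃ b' < b, Bd G b' := by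
  have key : ∀ (ι : Type) (_ : Fintype ι) (pts : ι → Fin 3 → k), Cfg pts → (∀ i, NonOrd G (pts i)) → Fintype.card ι + 1 ≤ b := by
    intro ι _ pts hp hn
    have hoff : ∀ i j, pts i j ≠ 0 := by
      intro i
      rcases h.nonOrd_cases (hn i) with h1 | ⟨h1, h2, h3⟩
      · exact h1
      · exact (hno _ h1 h2 h3 (hn i).2.1).elim
    have hc : Cfg (fun i => Qv (pts i)) := by
      refine ⟨fun i h0 => Qv_ne (hoff i) 0 (congrFun h0 0), fun i j hij c hc => ?_⟩
      obtain ⟨d, hd⟩ := Qv_prop (hoff i) hc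
      exact hp.2 i j hij d hd
    have hc2 := cfg_option hc (v := Pi.single 2 1) (by simp) (by
      intro i c hh
      have := congrFun hh 0
      simp at this
      exact Qv_ne (hoff i) 0 this)
    have := hb (Option ι) inferInstance _ hc2 (by
      rintro (_ | i)
      · exact he
      · exact h.off_nonOrd (hoff i) (hn i))
    simpa using this
  have hb1 := key Empty inferInstance Empty.elim ⟨fun i => i.elim, fun i => i.elim⟩ (fun i => i.elim)
  refine ⟨b - 1, by omega, fun ι _ pts hp hn => ?_⟩
  have := key ι inferInstance pts hp hn
  omega
end Exc

/-- Finite chains of quadratic transformations ending in a curve without non-ordinary points. -/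
inductive Chain : PlaneCurve k → Prop
  | done (C : PlaneCurve k) (h : ∀ v, ¬ NonOrd C.F v) : Chain C
  | step (C D : PlaneCurve k) (h : ∃ φ, IsQuadTrans φ ∧ TransformsInto φ C.F D.F) (hD : Chain D) : Chain C

lemma chain_main [IsAlgClosed k] [CharZero k] (a b : ℕ) : ∀ C : PlaneCurve k, Gd C.F C.n a → Bd C.F b → Chain C := by
  induction a using Nat.strong_induction_on generalizing b with
  | _ a iha =>
  induction b using Nat.strong_induction_on with
  | _ b ihb =>
  intro C hg hb
  by_cases hall : ∀ v, ¬ NonOrd C.F v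
  · exact Chain.done C hall
  push Not at hall
  obtain ⟨P, hP⟩ := hall
  obtain ⟨A, G, r, h, he⟩ := exists_exc C.homog C.irred hP
  let D : PlaneCurve k := ⟨2 * C.n - r, G, h.homG, h.irrG⟩
  have htr : ∃ φ, IsQuadTrans φ ∧ TransformsInto φ C.F D.F := by
    have := h.trans A⁻¹
    rw [bind₁_linMap_mul, mul_inv_cancel, bind₁_linMap_one] at this
    exact this
  refine Chain.step C D htr ?_
  have hg' := Gd_lin A C.irred.ne_zero hg
  have hb' := Bd_lin A C.irred.ne_zero hb
  by_cases hex : ∃ v : Fin 3 → k, v 2 = 0 ∧ v 0 ≠ 0 ∧ v 1 ≠ 0 ∧ Polynomial.X ^ 2 ∣ tay v G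
  · obtain ⟨v, h2, h0, h1, hd⟩ := hex
    obtain ⟨a', ha', hg2⟩ := h.gd_drop hg' h2 h0 h1 hd
    obtain ⟨b', hb2⟩ := exists_Bd h.homG h.irrG
    exact iha a' ha' b' D hg2 hb2
  · push Not at hex
    obtain ⟨b', hb'', hb2⟩ := h.bd_drop hb' he hex
    exact ihb b' hb'' D (h.gd_same hg') hb2

lemma chain_seq {C : PlaneCurve k} (h : Chain C) : ∃ (r : ℕ) (seq : Fin (r + 1) → PlaneCurve k),
      seq 0 = C ∧
      (∀ i : Fin r, ∃ φ : Fin 3 → MvPolynomial (Fin 3) k,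
        IsQuadTrans φ ∧ TransformsInto φ (seq i.castSucc).F (seq i.succ).F) ∧
      ∀ v, ¬ NonOrd (seq (Fin.last r)).F v := by
  induction h with
  | done C h => exact ⟨0, fun _ => C, rfl, fun i => i.elim0, h⟩
  | step C D h hD ih =>
    obtain ⟨r, seq, h0, h1, h2⟩ := ih
    refine ⟨r + 1, Fin.cons C seq, rfl, ?_, ?_⟩
    · intro i
      refine Fin.cases ?_ (fun i => ?_) i
      · rw [Fin.castSucc_zero, Fin.cons_zero, Fin.cons_succ, h0]; exact h
      · rw [← Fin.succ_castSucc, Fin.cons_succ, Fin.cons_succ]; exact h1 i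
    · rw [← Fin.succ_last, Fin.cons_succ]; exact h2

/-- Every irreducible plane algebraic curve can be transformed by a finite
sequence of quadratic (Cremona) transformations into a curve all of whose singular points
are ordinary, i.e. each singular point of multiplicity `m` has `m` distinct tangents. -/
theorem resolve_to_ordinary_singularities_by_quadratic_transformations
    (k : Type) [Field k] [IsAlgClosed k] [CharZero k] (C : PlaneCurve k) :
    ∃ (r : ℕ) (seq : Fin (r + 1) → PlaneCurve k),
      seq 0 = C ∧
      (∀ i : Fin r, ∃ φ : Fin 3 → MvPolynomial (Fin 3) k,
        IsQuadTrans φ ∧ TransformsInto φ (seq i.castSucc).F (seq i.succ).F) ∧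
      ∀ (v : Fin 3 → k) (m : ℕ),
        IsSingularAt (seq (Fin.last r)).F v → HasMultiplicityAt (seq (Fin.last r)).F v m →
          IsOrdinaryAt (seq (Fin.last r)).F v m := by
  obtain ⟨a, ha⟩ := exists_Gd C.F C.n
  obtain ⟨b, hb⟩ := exists_Bd C.homog C.irred
  obtain ⟨r, seq, h0, h1, h2⟩ := chain_seq (chain_main a b C ha hb)
  refine ⟨r, seq, h0, h1, fun v m hs hm => ?_⟩
  by_contra hc
  apply h2 v
  have hs' := (isSingularAt_iff _ v).1 hs
  have hm' := (hasMultiplicityAt_iff _ v m).1 hm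
  refine ⟨hs'.1, hs'.2, m, Polynomial.X_pow_dvd_iff.2 hm'.1, hm'.2, fun hd => hc ?_⟩
  exact (isOrdinaryAt_iff _ v m hm).2 hd
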